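/- arXiv:1211.5959 — 2 statements merged into one kernel-verified Lean document; each statement's English description precedes it below -/
import Mathlib

section
/- Let T be a Laver tree, let I be an F_σ P-ideal on ℕ, and let E be a Borel equivalence relation on [T] that is Borel reducible to E_I. Then there is a Laver tree S with S ⊆ T such that the restriction of E to [S] is either the identity relation on [S] or the full relation [S] × [S]. -/
open Set Filter

/-- The restriction of `x : ℕ → ℕ` to `{0,…,n-1}`, as a finite sequence. -/
def seg (x : ℕ → ℕ) (n : ℕ) : List ℕ := List.ofFn fun i : Fin n => x i

/-- `s` is the stem of the tree `T`: it belongs to `T`, is comparable with every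
element of `T`, and every node of `T` extending it splits infinitely. -/
def IsStemOf (T : Set (List ℕ)) (s : List ℕ) : Prop :=
  s ∈ T ∧ (∀ t ∈ T, t <+: s ∨ s <+: t) ∧
    ∀ t ∈ T, s <+: t → {n : ℕ | t ++ [n] ∈ T}.Infinite

/-- A Laver tree: closed under initial segments, with a stem. -/
def IsLaverTree (T : Set (List ℕ)) : Prop :=
  (∀ s ∈ T, ∀ t : List ℕ, t <+: s → t ∈ T) ∧ ∃ s, IsStemOf T s

/-- `[T]`, the set of branches of `T`. -/
def branches (T : Set (List ℕ)) : Set (ℕ → ℕ) := {x | ∀ n, seg x n ∈ T}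

/-- `S ≤₀ T`: `S` is a Laver tree included in `T` with the same stem. -/
def DirectExt (S T : Set (List ℕ)) : Prop :=
  IsLaverTree S ∧ S ⊆ T ∧ ∃ s, IsStemOf S s ∧ IsStemOf T s

/-- An (proper, containing all finite sets) ideal on ℕ. -/
def IsIdeal (I : Set (Set ℕ)) : Prop :=
  (∀ A : Set ℕ, A.Finite → A ∈ I) ∧ (∀ A B : Set ℕ, A ⊆ B → B ∈ I → A ∈ I) ∧
    (∀ A B : Set ℕ, A ∈ I → B ∈ I → A ∪ B ∈ I) ∧ (Set.univ : Set ℕ) ∉ I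

/-- A P-ideal. -/
def IsPIdeal (I : Set (Set ℕ)) : Prop :=
  ∀ A : ℕ → Set ℕ, (∀ n, A n ∈ I) → ∃ B ∈ I, ∀ n, (A n \ B).Finite

/-- Characteristic function of a subset of ℕ, as a point of the Cantor space. -/
noncomputable def chi (A : Set ℕ) : ℕ → Bool :=
  fun n => @decide (n ∈ A) (Classical.propDecidable _)

/-- An F_σ set: a countable union of closed sets. -/
def IsFsigma {X : Type*} [TopologicalSpace X] (A : Set X) : Prop :=
  ∃ F : ℕ → Set X, (∀ n, IsClosed (F n)) ∧ A = ⋃ n, F n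

/-- An ideal on ℕ is F_σ if its copy in the Cantor space `ℕ → Bool` is F_σ. -/
def FsigmaIdeal (I : Set (Set ℕ)) : Prop := IsFsigma (chi '' I)

/-- The equivalence relation `E_I` on the Cantor space induced by an ideal `I`. -/
def EI (I : Set (Set ℕ)) (x y : ℕ → Bool) : Prop := {n | x n ≠ y n} ∈ I

/-- The generator `A_g` of the Laver ideal. -/
def laverGen (g : List ℕ → ℕ) : Set (ℕ → ℕ) := {f | {n | f n < g (seg f n)}.Infinite}

/-- Membership in the Laver ideal: covered by countably many generators. -/
def InLaverIdeal (A : Set (ℕ → ℕ)) : Prop :=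
  ∃ g : ℕ → List ℕ → ℕ, A ⊆ ⋃ i, laverGen (g i)

/-- The relation `K` on the Baire space. -/
def Krel (x y : ℕ → ℕ) : Prop :=
  ∃ b : ℕ, ∀ n : ℕ, ∃ mx ≤ b, ∃ my ≤ b, x n ≤ y (n + my) ∧ y n ≤ x (n + mx)

/-- `E_{ℓ∞}` on `ℝ^ℕ`: the difference sequence is bounded. -/
def Elinf (x y : ℕ → ℝ) : Prop := ∃ C : ℝ, ∀ n, |x n - y n| ≤ C

/-- A lower semicontinuous submeasure on ℕ. -/
def IsLSCSubmeasure (μ : Set ℕ → ENNReal) : Prop :=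
  μ ∅ = 0 ∧ (∀ A B : Set ℕ, A ⊆ B → μ A ≤ μ B) ∧
    (∀ A B : Set ℕ, μ (A ∪ B) ≤ μ A + μ B) ∧
    ∀ A : Set ℕ, μ A = ⨆ n : ℕ, μ (A ∩ Set.Iio n)

/-- `Exh(μ)`. -/
def Exh (μ : Set ℕ → ENNReal) : Set (Set ℕ) :=
  {A | Filter.Tendsto (fun n : ℕ => μ (A \ Set.Iio n)) Filter.atTop (nhds 0)}

/-- `Fin(μ)`. -/
def FinSub (μ : Set ℕ → ENNReal) : Set (Set ℕ) := {A | μ A < ⊤}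

theorem length_seg (x : ℕ → ℕ) (n : ℕ) : (seg x n).length = n := by simp [seg]

theorem seg_succ (x : ℕ → ℕ) (n : ℕ) : seg x (n + 1) = seg x n ++ [x n] := by
  rw [seg, List.ofFn_succ_last]
  rfl

theorem seg_eq_seg_iff {x y : ℕ → ℕ} {n : ℕ} : seg x n = seg y n ↔ ∀ i < n, x i = y i := by
  unfold seg
  rw [List.ofFn_inj, funext_iff]
  exact ⟨fun h i hi => h ⟨i, hi⟩, fun h i => h i i.2⟩

theorem take_seg (x : ℕ → ℕ) {m n : ℕ} (h : m ≤ n) : (seg x n).take m = seg x m := by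
  apply List.ext_getElem
  · simp [length_seg, h]
  · intro i h1 h2
    simp [seg]

theorem seg_prefix_seg (x : ℕ → ℕ) {m n : ℕ} (h : m ≤ n) : seg x m <+: seg x n := by
  rw [← take_seg x h]
  exact ⟨_, List.take_append_drop _ _⟩

theorem eq_seg_of_isPrefix {x : ℕ → ℕ} {n : ℕ} {t : List ℕ} (h : t <+: seg x n) :
    t = seg x t.length := by
  rw [← take_seg x (h.length_le.trans_eq (length_seg x n))]
  exact List.prefix_iff_eq_take.1 h

/-- The infinite sequences extending `s` whose later values are chosen in the sets that `A`
assigns to the initial segments: the branches of a tree with stem `s`. -/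
def branchesFrom (s : List ℕ) (A : List ℕ → Set ℕ) : Set (ℕ → ℕ) :=
  {x | seg x s.length = s ∧ ∀ i, s.length ≤ i → x i ∈ A (seg x i)}

theorem branchesFrom_mono {s : List ℕ} {A A' : List ℕ → Set ℕ} (h : A' ≤ A) :
    branchesFrom s A' ⊆ branchesFrom s A :=
  fun _ hx => ⟨hx.1, fun i hi => h _ (hx.2 i hi)⟩

theorem mem_branchesFrom_seg {s : List ℕ} {A : List ℕ → Set ℕ} {x : ℕ → ℕ}
    (hx : x ∈ branchesFrom s A) {k : ℕ} (hk : s.length ≤ k) : x ∈ branchesFrom (seg x k) A := by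
  refine ⟨by rw [length_seg], fun i hi => hx.2 i ?_⟩
  rw [length_seg] at hi
  omega

theorem branchesFrom_seg_subset {s : List ℕ} {A : List ℕ → Set ℕ} {x : ℕ → ℕ}
    (hx : x ∈ branchesFrom s A) {k : ℕ} (hk : s.length ≤ k) :
    branchesFrom (seg x k) A ⊆ branchesFrom s A := by
  rintro y ⟨hy, hy'⟩
  rw [length_seg] at hy hy'
  refine ⟨?_, fun i hi => ?_⟩
  · rw [← take_seg y hk, hy, take_seg x hk, hx.1]
  · rcases le_or_gt k i with h | h
    · exact hy' i h
    · rw [seg_eq_seg_iff] at hy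
      have : seg y i = seg x i := seg_eq_seg_iff.2 fun j hj => hy j (hj.trans h)
      rw [this, hy i h]
      exact hx.2 i hi

theorem branchesFrom_nonempty (s : List ℕ) {A : List ℕ → Set ℕ} (hA : ∀ t, (A t).Infinite) :
    (branchesFrom s A).Nonempty := by
  choose c hc using fun t => (hA t).nonempty
  let next : ℕ → List ℕ → ℕ := fun i l => if i < s.length then s.getD i 0 else c l
  let L : ℕ → List ℕ := fun n => Nat.rec [] (fun i l => l ++ [next i l]) n
  have hL : ∀ n, seg (fun i => next i (L i)) n = L n := by
    intro n
    induction n with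
    | zero => simp [seg, L]
    | succ n ih => rw [seg_succ, ih]
  refine ⟨fun i => next i (L i), ?_, fun i hi => ?_⟩
  · apply List.ext_getElem
    · simp [length_seg]
    · intro i h1 h2
      simp [seg, next]
  · rw [hL]
    simp only [next, if_neg (not_lt.2 hi)]
    exact hc _

/-- The subtree of `A` above `t` with successor set `Y` at `t` that continues according to
`W n` above each successor `t ++ [n]`. -/
noncomputable def graft (t : List ℕ) (Y : Set ℕ) (W : ℕ → List ℕ → Set ℕ) : List ℕ → Set ℕ :=
  open Classical in fun u => if u = t then Y else W (u.getD t.length 0) u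

theorem graft_infinite {t : List ℕ} {Y : Set ℕ} {W : ℕ → List ℕ → Set ℕ} (hY : Y.Infinite)
    (hW : ∀ n u, (W n u).Infinite) (u : List ℕ) : (graft t Y W u).Infinite := by
  unfold graft
  split_ifs
  exacts [hY, hW _ _]

theorem graft_le {t : List ℕ} {Y : Set ℕ} {W : ℕ → List ℕ → Set ℕ} {A : List ℕ → Set ℕ}
    (hY : Y ⊆ A t) (hW : ∀ n, W n ≤ A) : graft t Y W ≤ A := by
  intro u
  unfold graft
  split_ifs with h
  · exact h ▸ hY
  · exact hW _ u

theorem mem_of_mem_branchesFrom_graft {t : List ℕ} {Y : Set ℕ} {W : ℕ → List ℕ → Set ℕ}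
    {x : ℕ → ℕ} (hx : x ∈ branchesFrom t (graft t Y W)) :
    seg x t.length = t ∧ x t.length ∈ Y ∧
      ∀ i, t.length < i → x i ∈ W (x t.length) (seg x i) := by
  refine ⟨hx.1, ?_, fun i hi => ?_⟩
  · have := hx.2 _ le_rfl
    rwa [hx.1, graft, if_pos rfl] at this
  · have := hx.2 i hi.le
    have hne : seg x i ≠ t := fun h => by
      have := congrArg List.length h
      rw [length_seg] at this
      omega
    have hget : (seg x i).getD t.length 0 = x t.length := by
      simp [seg, hi]
    rwa [graft, if_neg hne, hget] at this

/-- Fusion: a property of pairs (node, set of branches through it) which can be achieved above each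
node by a direct extension can be achieved above all nodes simultaneously. -/
theorem exists_fusion {P : List ℕ → Set (ℕ → ℕ) → Prop}
    (hP : ∀ t X Y, X ⊆ Y → P t Y → P t X)
    (hext : ∀ t A, (∀ u, (A u).Infinite) →
      ∃ A' ≤ A, (∀ u, (A' u).Infinite) ∧ P t (branchesFrom t A'))
    {A : List ℕ → Set ℕ} (hA : ∀ u, (A u).Infinite) :
    ∃ A' ≤ A, (∀ u, (A' u).Infinite) ∧ ∀ t, P t (branchesFrom t A') := by
  choose! Φ hle hinf hprop using hext
  let R : List ℕ → List ℕ → Set ℕ := fun l =>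
    List.rec (Φ [] A) (fun n l r => Φ (n :: l).reverse r) l
  have hRinf : ∀ l u, (R l u).Infinite := by
    intro l
    induction l with
    | nil => exact hinf [] A hA
    | cons n l ih => exact hinf _ _ ih
  have hRA : ∀ l, R l ≤ A := by
    intro l
    induction l with
    | nil => exact hle [] A hA
    | cons n l ih => exact (hle _ _ (hRinf l)).trans ih
  have hRP : ∀ l, P l.reverse (branchesFrom l.reverse (R l)) := by
    intro l
    cases l with
    | nil => exact hprop [] A hA
    | cons n l => exact hprop _ _ (hRinf l)
  have hanti : ∀ (x : ℕ → ℕ) k i, k ≤ i → R (seg x i).reverse ≤ R (seg x k).reverse := by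
    intro x k i hki
    induction i, hki using Nat.le_induction with
    | base => exact le_rfl
    | succ i hi ih =>
      rw [seg_succ, List.reverse_append]
      exact (hle _ _ (hRinf _)).trans ih
  refine ⟨fun u => R u.reverse u, fun u => hRA _ u, fun u => hRinf _ u, fun t => ?_⟩
  have := hRP t.reverse
  rw [List.reverse_reverse] at this
  refine hP _ (branchesFrom t fun u => R u.reverse u) _ ?_ this
  refine fun x hx => ⟨hx.1, fun i hi => ?_⟩
  have h2 := hanti x t.length i hi (seg x i) (hx.2 i hi)
  rwa [hx.1] at h2

/-- Every tree has a direct extension whose branches all lie in `B` or all lie outside `B`. -/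
def PurelyDecided (B : Set (ℕ → ℕ)) : Prop :=
  ∀ s A, (∀ u, (A u).Infinite) → ∃ A' ≤ A, (∀ u, (A' u).Infinite) ∧
    (branchesFrom s A' ⊆ B ∨ branchesFrom s A' ⊆ Bᶜ)

theorem purelyDecided_iUnion {B : ℕ → Set (ℕ → ℕ)} (hB : ∀ n, PurelyDecided (B n)) :
    PurelyDecided (⋃ n, B n) := by
  intro s A hA
  let Good : List ℕ → Prop := fun t =>
    ∃ A' ≤ A, (∀ u, (A' u).Infinite) ∧ branchesFrom t A' ⊆ ⋃ n, B n
  by_cases hs : Good s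
  · obtain ⟨A', h1, h2, h3⟩ := hs
    exact ⟨A', h1, h2, Or.inl h3⟩
  have hgood : ∀ t, {n | n ∈ A t ∧ Good (t ++ [n])}.Infinite → Good t := by
    intro t ht
    have hW : ∀ n, ∃ W ≤ A, (∀ u, (W u).Infinite) ∧
        (Good (t ++ [n]) → branchesFrom (t ++ [n]) W ⊆ ⋃ n, B n) := by
      intro n
      by_cases h : Good (t ++ [n])
      · obtain ⟨W, h1, h2, h3⟩ := h
        exact ⟨W, h1, h2, fun _ => h3⟩
      · exact ⟨A, le_rfl, hA, fun h' => absurd h' h⟩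
    choose W hWA hWinf hWB using hW
    refine ⟨graft t _ W, graft_le (fun n hn => hn.1) hWA, graft_infinite ht hWinf, ?_⟩
    intro x hx
    obtain ⟨h1, h2, h3⟩ := mem_of_mem_branchesFrom_graft hx
    refine hWB _ h2.2 ⟨?_, fun i hi => h3 i ?_⟩
    · rw [List.length_append, List.length_singleton, seg_succ, h1]
    · rw [List.length_append, List.length_singleton] at hi
      omega
  let A₁ : List ℕ → Set ℕ := fun t => open Classical in
    if Good t then A t else A t \ {n | n ∈ A t ∧ Good (t ++ [n])}
  have hA₁A : A₁ ≤ A := by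
    intro t
    simp only [A₁]
    split_ifs
    exacts [subset_rfl, sdiff_subset]
  have hA₁ : ∀ t, (A₁ t).Infinite := by
    intro t
    simp only [A₁]
    split_ifs with h
    · exact hA t
    · exact (hA t).sdiff (not_infinite.1 fun h' => h (hgood t h'))
  have hbad : ∀ x ∈ branchesFrom s A₁, ∀ i, s.length ≤ i → ¬ Good (seg x i) := by
    intro x hx i hi
    induction i, hi using Nat.le_induction with
    | base => rwa [hx.1]
    | succ i hi ih =>
      have := hx.2 i hi
      simp only [A₁, if_neg ih] at this
      rw [seg_succ]
      exact fun h => this.2 ⟨this.1, h⟩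
  obtain ⟨A₂, h₂₁, h₂, hdec⟩ := exists_fusion
    (P := fun t X => X ⊆ B t.length.unpair.1 ∨ X ⊆ (B t.length.unpair.1)ᶜ)
    (fun t X Y hXY h => h.imp hXY.trans hXY.trans) (fun t A hA => hB _ t A hA) hA₁
  refine ⟨A₂, h₂₁.trans hA₁A, h₂, Or.inr fun x hx hxB => ?_⟩
  obtain ⟨n, hn⟩ := mem_iUnion.1 hxB
  have hle : s.length ≤ Nat.pair n s.length := Nat.right_le_pair _ _
  have hxt := mem_branchesFrom_seg hx hle
  rcases hdec (seg x (Nat.pair n s.length)) with h | h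
  · exact hbad x (branchesFrom_mono h₂₁ hx) _ hle
      ⟨A₂, h₂₁.trans hA₁A, h₂, h.trans (subset_iUnion _ _)⟩
  · have := h hxt
    rw [length_seg, Nat.unpair_pair] at this
    exact this hn

theorem MeasurableSet.purelyDecided {B : Set (ℕ → ℕ)} (hB : MeasurableSet B) :
    PurelyDecided B := by
  let m : MeasurableSpace (ℕ → ℕ) :=
    { MeasurableSet' := PurelyDecided
      measurableSet_empty := fun s A hA => ⟨A, le_rfl, hA, Or.inr (by simp)⟩
      measurableSet_compl := fun B hB s A hA => by
        obtain ⟨A', h1, h2, h3⟩ := hB s A hA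
        exact ⟨A', h1, h2, by rwa [compl_compl, or_comm]⟩
      measurableSet_iUnion := fun B hB => purelyDecided_iUnion hB }
  have hle : (MeasurableSpace.pi : MeasurableSpace (ℕ → ℕ)) ≤ m := by
    refine iSup_le fun i => ?_
    rw [← measurable_iff_comap_le]
    refine @measurable_to_countable' ℕ (ℕ → ℕ) _ _ m _ fun n => ?_
    intro s A hA
    rcases lt_or_ge i s.length with h | h
    · refine ⟨A, le_rfl, hA, ?_⟩
      have hval : ∀ x ∈ branchesFrom s A, x i = s[i] := by
        intro x hx
        have h1 : s[i] = (seg x s.length)[i]'(by rwa [length_seg]) := by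
          congr 1
          exact hx.1.symm
        rw [h1]
        simp [seg]
      by_cases hn : s[i] = n
      · exact Or.inl fun x hx => (hval x hx).trans hn
      · exact Or.inr fun x hx hx' => hn ((hval x hx).symm.trans hx')
    · refine ⟨fun t => A t \ {n}, fun t => sdiff_subset,
        fun t => (hA t).sdiff (finite_singleton n), Or.inr fun x hx hx' => ?_⟩
      exact (hx.2 i h).2 hx'
  exact hle _ hB

/-- Above a fixed node `t`, the values of `f` can be made to converge to a limit as the next
coordinate tends to infinity. -/
theorem exists_limit_at {f : (ℕ → ℕ) → ℕ → Bool} (hf : Measurable f) (t : List ℕ)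
    {A : List ℕ → Set ℕ} (hA : ∀ u, (A u).Infinite) :
    ∃ A' ≤ A, (∀ u, (A' u).Infinite) ∧ ∃ (z : ℕ → Bool) (h : ℕ → ℕ),
      ∀ x ∈ branchesFrom t A', ∀ a, h a ≤ x t.length → ∀ q < a, f x q = z q := by
  have step : ∀ (q : ℕ) (D : List ℕ → Set ℕ), (∀ u, (D u).Infinite) →
      ∃ D' ≤ D, (∀ u, (D' u).Infinite) ∧ ∃ b, ∀ x ∈ branchesFrom t D', f x q = b := by
    intro q D hD
    have hm : MeasurableSet {x | f x q = true} :=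
      ((measurable_pi_apply q).comp hf) (measurableSet_singleton true)
    obtain ⟨D', h1, h2, h3 | h3⟩ := hm.purelyDecided t D hD
    · exact ⟨D', h1, h2, true, h3⟩
    · exact ⟨D', h1, h2, false, fun x hx => by simpa using h3 hx⟩
  choose! G hGle hGinf z hz using step
  let D : ℕ → List ℕ → Set ℕ := fun k => Nat.rec A (fun q d => G q d) k
  have hDinf : ∀ k u, (D k u).Infinite := by
    intro k
    induction k with
    | zero => exact hA
    | succ k ih => exact hGinf k _ ih
  have hDanti : Antitone D := antitone_nat_of_succ_le fun k => hGle k _ (hDinf k)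
  obtain ⟨φ, hφ, hφD⟩ := extraction_forall_of_frequently (P := fun k n => n ∈ D k t)
    fun k => Nat.frequently_atTop_iff_infinite.2 (hDinf k t)
  have hinv : ∀ k, Function.invFun φ (φ k) = k := Function.leftInverse_invFun hφ.injective
  refine ⟨graft t (range φ) fun n => D (Function.invFun φ n), graft_le ?_ ?_,
    graft_infinite (infinite_range_of_injective hφ.injective) fun n => hDinf _,
    fun q => z q (D q), φ, ?_⟩
  · rintro _ ⟨k, rfl⟩
    exact hDanti (Nat.zero_le k) t (hφD k)
  · exact fun n => hDanti (Nat.zero_le _)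
  · intro x hx a ha q hq
    obtain ⟨h1, ⟨k, hk⟩, h3⟩ := mem_of_mem_branchesFrom_graft hx
    rw [← hk, hφ.le_iff_le] at ha
    refine hz q (D q) (hDinf q) x ⟨h1, fun i hi => ?_⟩
    have hle : D k ≤ D (q + 1) := hDanti (hq.trans_le ha : q < k)
    rcases hi.eq_or_lt with rfl | hi
    · rw [h1, ← hk]
      exact hle t (hφD k)
    · have := h3 i hi
      rw [← hk, hinv] at this
      exact hle _ this

theorem exists_limits {f : (ℕ → ℕ) → ℕ → Bool} (hf : Measurable f)
    {A : List ℕ → Set ℕ} (hA : ∀ u, (A u).Infinite) :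
    ∃ A' ≤ A, (∀ u, (A' u).Infinite) ∧ ∃ (F : List ℕ → ℕ → Bool) (h : List ℕ → ℕ → ℕ),
      ∀ t, ∀ x ∈ branchesFrom t A', ∀ a, h t a ≤ x t.length → ∀ q < a, f x q = F t q := by
  obtain ⟨A', h1, h2, h3⟩ := exists_fusion
    (P := fun t X => ∃ (z : ℕ → Bool) (h : ℕ → ℕ),
      ∀ x ∈ X, ∀ a, h a ≤ x t.length → ∀ q < a, f x q = z q)
    (fun t X Y hXY ⟨z, h, hz⟩ => ⟨z, h, fun x hx => hz x (hXY hx)⟩)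
    (fun t A hA => exists_limit_at hf t hA) hA
  choose F h hF using h3
  exact ⟨A', h1, h2, F, h, hF⟩

/-- A size of finite sequences for which only finitely many sequences lie below each bound. -/
def weight (t : List ℕ) : ℕ := t.foldl (fun w n => max (w + 1) n) 0

theorem weight_append (t : List ℕ) (n : ℕ) : weight (t ++ [n]) = max (weight t + 1) n := by
  simp [weight]

theorem finite_weight_le (N : ℕ) : {t | weight t ≤ N}.Finite := by
  have hlen : ∀ t : List ℕ, t.length ≤ weight t ∧ ∀ a ∈ t, a ≤ weight t := by
    intro t
    induction t using List.reverseRecOn with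
    | nil => simp
    | append_singleton t n ih =>
      rw [weight_append]
      refine ⟨by simp; omega, fun a ha => ?_⟩
      rcases List.mem_append.1 ha with ha | ha
      · have := ih.2 a ha
        omega
      · rw [List.mem_singleton.1 ha]
        exact le_max_right _ _
  refine ((List.finite_length_le (Fin (N + 1)) N).image (List.map Fin.val)).subset ?_
  intro t ht
  have h1 := hlen t
  have ht' : weight t ≤ N := ht
  have h2 : ∀ a ∈ t, a < N + 1 := fun a ha => Nat.lt_succ_of_le ((h1.2 a ha).trans ht')
  refine ⟨t.pmap (fun a ha => ⟨a, ha⟩) h2, ?_, ?_⟩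
  · simpa using h1.1.trans ht'
  · simp [List.map_pmap]

theorem exists_monotone_forall {R : ℕ → ℕ → Prop} (h : ∀ N, ∀ᶠ a in atTop, R N a) :
    ∃ p : ℕ → ℕ, Monotone p ∧ ∀ N, N ≤ p N ∧ R N (p N) := by
  choose a ha using fun N => eventually_atTop.1 (h N)
  refine ⟨partialSups fun N => max (a N) N, (partialSups _).monotone, fun N => ?_⟩
  have := le_partialSups (fun N => max (a N) N) N
  exact ⟨(le_max_right _ _).trans this, ha N _ ((le_max_left _ _).trans this)⟩

/-- Countably many infinite sets can be shrunk to disjoint infinite sets with sparse union. -/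
theorem exists_sparse {A : List ℕ → Set ℕ} (hA : ∀ u, (A u).Infinite) (s : List ℕ)
    {H : ℕ → ℕ} (hH : Monotone H) :
    ∃ A' ≤ A, (∀ u, (A' u).Infinite) ∧ ∃ Z : Set ℕ, (∀ t, A' t ⊆ Z) ∧
      (∀ t u n, n ∈ A' t → n ∈ A' u → t = u) ∧ (∀ a ∈ Z, ∀ b ∈ Z, a < b → H a ≤ b) ∧
      (∀ t, ∀ n ∈ A' t, weight t < n) ∧ ∀ n ∈ Z, weight s ≤ n := by
  let e : ℕ → List ℕ := fun k => (Encodable.decode (α := List ℕ) k.unpair.1).getD []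
  have hex : ∀ k a, ∃ n ∈ A (e k), max (max a (weight (e k))) (weight s) < n :=
    fun k a => (hA (e k)).exists_gt _
  choose g hgA hg using hex
  let z : ℕ → ℕ := fun k => Nat.rec (g 0 0) (fun k a => g (k + 1) (max a (H a))) k
  have hz_succ : ∀ k, z (k + 1) = g (k + 1) (max (z k) (H (z k))) := fun _ => rfl
  have hzmem : ∀ k, z k ∈ A (e k) ∧ weight (e k) < z k ∧ weight s < z k := by
    intro k
    cases k with
    | zero =>
      have := hg 0 0
      exact ⟨hgA _ _, by change _ < g 0 0; omega, by change _ < g 0 0; omega⟩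
    | succ k =>
      have := hg (k + 1) (max (z k) (H (z k)))
      rw [← hz_succ] at this
      exact ⟨hgA _ _, by omega, by omega⟩
  have hzs : ∀ k, z k < z (k + 1) ∧ H (z k) ≤ z (k + 1) := by
    intro k
    have := hg (k + 1) (max (z k) (H (z k)))
    rw [← hz_succ] at this
    omega
  have hz : StrictMono z := strictMono_nat_of_lt_succ fun k => (hzs k).1
  refine ⟨fun t => {n | ∃ k, e k = t ∧ z k = n}, ?_, fun t => ?_, range z, ?_, ?_, ?_, ?_, ?_⟩
  · rintro t n ⟨k, rfl, rfl⟩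
    exact (hzmem k).1
  · refine infinite_of_injective_forall_mem
      (f := fun j => z (Nat.pair (Encodable.encode t) j)) ?_ fun j => ⟨_, ?_, rfl⟩
    · intro i j hij
      simpa using hz.injective hij
    · simp [e]
  · rintro t n ⟨k, -, rfl⟩
    exact ⟨k, rfl⟩
  · rintro t u n ⟨k, rfl, rfl⟩ ⟨l, rfl, hl⟩
    rw [hz.injective hl]
  · rintro _ ⟨k, rfl⟩ _ ⟨l, rfl⟩ hkl
    rw [hz.lt_iff_lt] at hkl
    obtain ⟨l, rfl⟩ : ∃ l', l = l' + 1 := ⟨l - 1, by omega⟩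
    exact (hH (hz.monotone (Nat.lt_succ_iff.1 hkl))).trans (hzs l).2
  · rintro t n ⟨k, rfl, rfl⟩
    exact (hzmem k).2.1
  · rintro _ ⟨k, rfl⟩
    exact (hzmem k).2.2.le

/-- The tree given by `s` and `A` has sparse branches along which `f` stays close, to the extent
prescribed by `p`, to the limits `F`. -/
structure IsSparse (f : (ℕ → ℕ) → ℕ → Bool) (F : List ℕ → ℕ → Bool) (p : ℕ → ℕ)
    (s : List ℕ) (A : List ℕ → Set ℕ) (Z : Set ℕ) : Prop where
  mem : ∀ {x}, x ∈ branchesFrom s A → ∀ {i}, s.length ≤ i → x i ∈ Z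
  weight_stem_le : ∀ {M}, M ∈ Z → weight s ≤ M
  weight_le : ∀ {x}, x ∈ branchesFrom s A → ∀ {i}, s.length ≤ i → weight (seg x (i + 1)) ≤ x i
  lt : ∀ {x}, x ∈ branchesFrom s A → ∀ {i}, s.length ≤ i → x i < x (i + 1)
  eq : ∀ {x y}, x ∈ branchesFrom s A → y ∈ branchesFrom s A → ∀ {i j}, s.length ≤ i →
    s.length ≤ j → x i = y j → i = j ∧ seg x i = seg y i
  agree : ∀ {x}, x ∈ branchesFrom s A → ∀ {i}, s.length ≤ i → ∀ {M}, M ∈ Z →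
    weight (seg x i) ≤ M → M < x i → ∀ q < p M, f x q = F (seg x i) q

theorem exists_isSparse {f : (ℕ → ℕ) → ℕ → Bool} {A : List ℕ → Set ℕ}
    (hA : ∀ u, (A u).Infinite) {F : List ℕ → ℕ → Bool} {h : List ℕ → ℕ → ℕ}
    (hF : ∀ t, ∀ x ∈ branchesFrom t A, ∀ a, h t a ≤ x t.length → ∀ q < a, f x q = F t q)
    (s : List ℕ) (p : ℕ → ℕ) :
    ∃ A' ≤ A, (∀ u, (A' u).Infinite) ∧ ∃ Z, IsSparse f F p s A' Z := by
  obtain ⟨H, hH, hHh⟩ := exists_monotone_forall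
    (R := fun N a => ∀ t ∈ {t | weight t ≤ N}, h t (p N) ≤ a)
    fun N => (eventually_all_finite (finite_weight_le N)).2 fun t _ => eventually_ge_atTop _
  obtain ⟨A', hle, hinf, Z, hZ, hdisj, hsp, hw, hs⟩ := exists_sparse hA s hH
  have hwle : ∀ {x}, x ∈ branchesFrom s A' → ∀ {i}, s.length ≤ i →
      weight (seg x (i + 1)) ≤ x i := by
    intro x hx i hi
    rw [seg_succ, weight_append]
    exact max_le (hw _ _ (hx.2 i hi)) le_rfl
  refine ⟨A', hle, hinf, Z, fun hx i hi => hZ _ (hx.2 i hi), fun hM => hs _ hM, hwle,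
    fun {x} hx i hi => ?_, ?_, ?_⟩
  · refine lt_of_le_of_lt ?_ (hw _ _ (hx.2 (i + 1) (by omega)))
    rw [seg_succ, weight_append]
    exact le_max_right _ _
  · intro x y hx hy i j hi hj hij
    have := hdisj _ _ _ (hx.2 i hi) (hij ▸ hy.2 j hj)
    have hlen := congrArg List.length this
    rw [length_seg, length_seg] at hlen
    subst hlen
    exact ⟨rfl, this⟩
  · intro x hx i hi M hM hwM hMx
    refine hF _ x (mem_branchesFrom_seg (branchesFrom_mono hle hx) hi) _ ?_
    rw [length_seg]
    exact ((hHh M).2 _ hwM).trans (hsp M hM _ (hZ _ (hx.2 i hi)) hMx)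

theorem IsSparse.weight_seg_le {f : (ℕ → ℕ) → ℕ → Bool} {F : List ℕ → ℕ → Bool} {p : ℕ → ℕ}
    {s : List ℕ} {A : List ℕ → Set ℕ} {Z : Set ℕ} (hS : IsSparse f F p s A Z) {x : ℕ → ℕ}
    (hx : x ∈ branchesFrom s A) {i M : ℕ} (hi : s.length ≤ i) (hM : M ∈ Z)
    (h : ∀ j, s.length ≤ j → j < i → x j ≤ M) : weight (seg x i) ≤ M := by
  rcases hi.eq_or_lt with rfl | hi
  · rw [hx.1]
    exact hS.weight_stem_le hM
  · obtain ⟨i, rfl⟩ : ∃ i', i = i' + 1 := ⟨i - 1, by omega⟩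
    exact (hS.weight_le hx (by omega)).trans (h i (by omega) (by omega))

theorem IsSparse.strictMonoOn {f : (ℕ → ℕ) → ℕ → Bool} {F : List ℕ → ℕ → Bool} {p : ℕ → ℕ}
    {s : List ℕ} {A : List ℕ → Set ℕ} {Z : Set ℕ} (hS : IsSparse f F p s A Z) {x : ℕ → ℕ}
    (hx : x ∈ branchesFrom s A) {i j : ℕ} (hi : s.length ≤ i) (hij : i < j) : x i < x j := by
  induction j, hij using Nat.le_induction with
  | base => exact hS.lt hx hi
  | succ j hj ih => exact ih.trans (hS.lt hx (by omega))

theorem IsSparse.exists_le {f : (ℕ → ℕ) → ℕ → Bool} {F : List ℕ → ℕ → Bool} {p : ℕ → ℕ}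
    {s : List ℕ} {A : List ℕ → Set ℕ} {Z : Set ℕ} (hS : IsSparse f F p s A Z) {x : ℕ → ℕ}
    (hx : x ∈ branchesFrom s A) (m : ℕ) : ∃ i, s.length ≤ i ∧ m ≤ x i := by
  induction m with
  | zero => exact ⟨_, le_rfl, Nat.zero_le _⟩
  | succ m ih =>
    obtain ⟨i, hi, him⟩ := ih
    exact ⟨i + 1, by omega, him.trans_lt (hS.lt hx hi)⟩

theorem EI.refl {I : Set (Set ℕ)} (hI : IsIdeal I) (x : ℕ → Bool) : EI I x x :=
  hI.1 _ (by simp)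

theorem EI.symm {I : Set (Set ℕ)} {x y : ℕ → Bool} (h : EI I x y) : EI I y x := by
  simpa only [EI, ne_comm] using h

theorem EI.trans {I : Set (Set ℕ)} (hI : IsIdeal I) {x y z : ℕ → Bool} (h : EI I x y)
    (h' : EI I y z) : EI I x z := by
  refine hI.2.1 _ _ (fun n hn => ?_) (hI.2.2.1 _ _ h h')
  by_contra hc
  simp only [mem_union, mem_ofPred_eq, not_or, not_not] at hc
  exact hn (hc.1.trans hc.2)

/-- An `F_σ` ideal is an increasing union of hereditary families that are closed, in the sense that
non-membership is witnessed by a finite set. -/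
theorem FsigmaIdeal.exists_filtration {I : Set (Set ℕ)} (hI : IsIdeal I) (hF : FsigmaIdeal I) :
    ∃ K : ℕ → Set (Set ℕ), Monotone K ∧ (∀ m D D', D ⊆ D' → D' ∈ K m → D ∈ K m) ∧
      (∀ m, ∀ D ∉ K m, ∃ a, D ∩ Iio a ∉ K m) ∧ ∀ D, D ∈ I ↔ ∃ m, D ∈ K m := by
  obtain ⟨C, hC, hCI⟩ := hF
  have hacc : ∀ m, IsClosed (accumulate C m) := fun m =>
    (finite_Iic m).isClosed_biUnion fun i _ => hC i
  refine ⟨fun m => {D | ∃ z ∈ accumulate C m, ∀ q ∈ D, z q = true}, ?_, ?_, ?_, ?_⟩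
  · rintro m n hmn D ⟨z, hz, hD⟩
    exact ⟨z, monotone_accumulate hmn hz, hD⟩
  · rintro m D D' hDD' ⟨z, hz, hD⟩
    exact ⟨z, hz, fun q hq => hD q (hDD' hq)⟩
  · intro m D hD
    by_contra! hc
    have hcl : ∀ a, IsClosed (accumulate C m ∩ {z | ∀ q ∈ D ∩ Iio a, z q = true}) := by
      intro a
      refine (hacc m).inter ?_
      simp only [ofPred_forall]
      exact isClosed_iInter fun q => isClosed_iInter fun _ =>
        isClosed_eq (continuous_apply q) continuous_const
    obtain ⟨z, hz⟩ := IsCompact.nonempty_iInter_of_sequence_nonempty_isCompact_isClosed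
      (fun a => accumulate C m ∩ {z : ℕ → Bool | ∀ q ∈ D ∩ Iio a, z q = true})
      (fun a z hz => ⟨hz.1, fun q hq => hz.2 q ⟨hq.1, lt_trans hq.2 (Nat.lt_succ_self a)⟩⟩)
      (fun a => hc a) (hcl 0).isCompact hcl
    rw [mem_iInter] at hz
    exact hD ⟨z, (hz 0).1, fun q hq => (hz (q + 1)).2 q ⟨hq, Nat.lt_succ_self q⟩⟩
  · intro D
    constructor
    · intro hD
      have : chi D ∈ ⋃ n, C n := hCI ▸ mem_image_of_mem chi hD
      obtain ⟨m, hm⟩ := mem_iUnion.1 this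
      exact ⟨m, chi D, subset_accumulate hm, fun q hq => by simpa [chi] using hq⟩
    · rintro ⟨m, z, hz, hD⟩
      have : z ∈ chi '' I := hCI ▸ accumulate_subset_iUnion m hz
      obtain ⟨D', hD', rfl⟩ := this
      exact hI.2.1 D D' (fun q hq => by simpa [chi] using hD q hq) hD'

theorem FsigmaIdeal.measurableSet_EI {I : Set (Set ℕ)} (hF : FsigmaIdeal I)
    {f : (ℕ → ℕ) → ℕ → Bool} (hf : Measurable f) (z : ℕ → Bool) :
    MeasurableSet {x | EI I (f x) z} := by
  obtain ⟨C, hC, hCI⟩ := hF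
  have hinj : Function.Injective chi := by
    intro D D' h
    ext q
    simpa [chi] using congrFun h q
  have hm : Measurable fun x => chi {n | f x n ≠ z n} := by
    refine measurable_pi_iff.2 fun n => ?_
    have hg : Measurable fun b : Bool => decide (b ≠ z n) := measurable_of_countable _
    convert hg.comp ((measurable_pi_apply n).comp hf) using 2 with x
    simp [chi]
  have hI : MeasurableSet (chi '' I) := hCI ▸ MeasurableSet.iUnion fun n => (hC n).measurableSet
  convert hm hI using 1
  ext x
  exact (hinj.mem_set_image).symm

theorem measurableSet_seg (Q : List ℕ → Prop) (k : ℕ) :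
    MeasurableSet {x : ℕ → ℕ | Q (seg x k)} := by
  have hm : Measurable fun (x : ℕ → ℕ) (i : Fin k) => x i :=
    measurable_pi_iff.2 fun i => measurable_pi_apply _
  exact hm (MeasurableSet.of_discrete (s := {y : Fin k → ℕ | Q (List.ofFn y)}))

/-- If the limits leave their `E_I`-class infinitely often along every branch, then distinct
branches of a sparse subtree are inequivalent. -/
theorem exists_pairwise_not_EI_of_change {I : Set (Set ℕ)} (hI : IsIdeal I) (hFs : FsigmaIdeal I)
    {f : (ℕ → ℕ) → ℕ → Bool} {A : List ℕ → Set ℕ}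
    (hA : ∀ u, (A u).Infinite) {F : List ℕ → ℕ → Bool} {h : List ℕ → ℕ → ℕ}
    (hF : ∀ t, ∀ x ∈ branchesFrom t A, ∀ a, h t a ≤ x t.length → ∀ q < a, f x q = F t q)
    (s : List ℕ) (hch : ∀ x ∈ branchesFrom s A, ∀ k, s.length ≤ k →
      ∃ j, k ≤ j ∧ ¬ EI I (F (seg x j)) (F (seg x (j + 1)))) :
    ∃ A' ≤ A, (∀ u, (A' u).Infinite) ∧
      ∀ x ∈ branchesFrom s A', ∀ y ∈ branchesFrom s A', x ≠ y → ¬ EI I (f x) (f y) := by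
  obtain ⟨K, hKmono, hKher, hKcl, hKI⟩ := hFs.exists_filtration hI
  obtain ⟨p, -, hp⟩ := exists_monotone_forall
    (R := fun N a => ∀ t ∈ {t | weight t ≤ N}, ∀ u ∈ {u | weight u ≤ N},
      ¬ EI I (F t) (F u) → {q | F t q ≠ F u q} ∩ Iio a ∉ K N) (fun N => by
    refine (eventually_all_finite (finite_weight_le N)).2 fun t _ =>
      (eventually_all_finite (finite_weight_le N)).2 fun u _ => ?_
    by_cases htu : EI I (F t) (F u)
    · exact Eventually.of_forall fun a h => absurd htu h
    · obtain ⟨a, ha⟩ := hKcl N {q | F t q ≠ F u q} fun hc => htu ((hKI _).2 ⟨N, hc⟩)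
      filter_upwards [eventually_ge_atTop a] with b hb _ hc
      exact ha (hKher _ _ _ (inter_subset_inter_right _ (Iio_subset_Iio hb)) hc))
  obtain ⟨A', hle, hinf, Z, hS⟩ := exists_isSparse hA hF s p
  refine ⟨A', hle, hinf, fun x hx y hy hxy hE => ?_⟩
  obtain ⟨m, hm⟩ := (hKI _).1 hE
  obtain ⟨d, hd⟩ := Function.ne_iff.1 hxy
  have pair : ∀ k j M, s.length ≤ k → s.length ≤ j → M ∈ Z → m ≤ M → M < x k → M < y j →
      (∀ i, s.length ≤ i → i < k → x i ≤ M) → (∀ i, s.length ≤ i → i < j → y i ≤ M) →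
      EI I (F (seg x k)) (F (seg y j)) := by
    intro k j M hk hj hM hmM hxk hyj hxi hyi
    by_contra hne
    have hwx := hS.weight_seg_le hx hk hM hxi
    have hwy := hS.weight_seg_le hy hj hM hyi
    refine (hp M).2 _ hwx _ hwy hne (hKher _ _ _ ?_ (hKmono hmM hm))
    rintro q ⟨hq, hqM⟩
    rw [mem_ofPred_eq, hS.agree hx hk hM hwx hxk q hqM, hS.agree hy hj hM hwy hyj q hqM]
    exact hq
  obtain ⟨i₀, hi₀, hmi₀⟩ := hS.exists_le hx m
  obtain ⟨k, hk, hne⟩ := hch x (branchesFrom_mono hle hx) (max (i₀ + 1) (d + 1)) (by omega)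
  have hmono : ∀ {w}, w ∈ branchesFrom s A' → ∀ {i j}, s.length ≤ i → i ≤ j → w i ≤ w j := by
    intro w hw i j hi hij
    rcases hij.eq_or_lt with rfl | hij
    · exact le_rfl
    · exact (hS.strictMonoOn hw hi hij).le
  classical
  have hex := hS.exists_le hy (x k)
  obtain ⟨hj, hjx⟩ := Nat.find_spec hex
  have hjmin : ∀ i, s.length ≤ i → i < Nat.find hex → y i < x k := fun i hi hij =>
    not_le.1 fun hc => Nat.find_min hex hij ⟨hi, hc⟩
  generalize Nat.find hex = j at hj hjx hjmin
  have hlt : x k < y j := by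
    refine hjx.lt_of_ne fun hc => ?_
    exact hd (seg_eq_seg_iff.1 (hS.eq hx hy (by omega) hj hc).2 d (by omega))
  have h₁ : EI I (F (seg x (k + 1))) (F (seg y j)) :=
    pair (k + 1) j (x k) (by omega) hj (hS.mem hx (by omega))
      (hmi₀.trans (hmono hx hi₀ (by omega))) (hS.lt hx (by omega)) hlt
      (fun i hi hik => hmono hx hi (by omega)) fun i hi hij => (hjmin i hi hij).le
  have hk1 : x (k - 1) < x k := hS.strictMonoOn hx (by omega) (by omega)
  have hmk : m ≤ x (k - 1) := hmi₀.trans (hmono hx hi₀ (by omega))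
  have hxk : ∀ i, s.length ≤ i → i < k → x i ≤ x (k - 1) := fun i hi hik =>
    hmono hx hi (by omega)
  have h₂ : EI I (F (seg x k)) (F (seg y j)) := by
    rcases hj.eq_or_lt with hj' | hj'
    · exact pair k j (x (k - 1)) (by omega) hj (hS.mem hx (by omega)) hmk hk1 (hk1.trans hlt)
        hxk fun i hi hij => by omega
    · have hyj : ∀ i, s.length ≤ i → i < j → y i ≤ y (j - 1) := fun i hi hij =>
        hmono hy hi (by omega)
      have hj1 := hjmin (j - 1) (by omega) (by omega)
      rcases le_total (x (k - 1)) (y (j - 1)) with hc | hc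
      · exact pair k j (y (j - 1)) (by omega) hj (hS.mem hy (by omega)) (hmk.trans hc) hj1
          (hj1.trans hlt) (fun i hi hik => (hxk i hi hik).trans hc) hyj
      · exact pair k j (x (k - 1)) (by omega) hj (hS.mem hx (by omega)) hmk hk1 (hk1.trans hlt)
          hxk fun i hi hij => (hyj i hi hij).trans hc
  exact hne (h₂.trans hI h₁.symm)

/-- If all limits lie in the `E_I`-class of the limit at the stem but `f` never does, then distinct
branches of a sparse subtree are inequivalent. -/
theorem exists_pairwise_not_EI_of_const {I : Set (Set ℕ)} (hI : IsIdeal I) (hP : IsPIdeal I)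
    {f : (ℕ → ℕ) → ℕ → Bool} {A : List ℕ → Set ℕ}
    (hA : ∀ u, (A u).Infinite) {F : List ℕ → ℕ → Bool} {h : List ℕ → ℕ → ℕ}
    (hF : ∀ t, ∀ x ∈ branchesFrom t A, ∀ a, h t a ≤ x t.length → ∀ q < a, f x q = F t q)
    (s : List ℕ)
    (hconst : ∀ x ∈ branchesFrom s A, ∀ k, s.length ≤ k → EI I (F (seg x k)) (F s))
    (hne : ∀ x ∈ branchesFrom s A, ¬ EI I (f x) (F s)) :
    ∃ A' ≤ A, (∀ u, (A' u).Infinite) ∧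
      ∀ x ∈ branchesFrom s A', ∀ y ∈ branchesFrom s A', x ≠ y → ¬ EI I (f x) (f y) := by
  classical
  obtain ⟨B, hBI, hB⟩ := hP
    (fun n => {q | ∃ u, Encodable.encode u = n ∧ EI I (F u) (F s) ∧ F u q ≠ F s q}) (fun n => by
    by_cases hu : ∃ u, Encodable.encode u = n ∧ EI I (F u) (F s)
    · obtain ⟨u, rfl, hu⟩ := hu
      refine hI.2.1 _ _ ?_ hu
      rintro q ⟨v, hv, -, hq⟩
      exact Encodable.encode_injective hv ▸ hq
    · refine hI.2.1 _ ∅ ?_ (hI.1 _ finite_empty)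
      rintro q ⟨v, hv, hv', -⟩
      exact hu ⟨v, hv, hv'⟩)
  obtain ⟨p, hpmono, hp⟩ := exists_monotone_forall
    (R := fun N a => ∀ u ∈ {u | weight u ≤ N}, EI I (F u) (F s) →
      ∀ q ∉ B, F u q ≠ F s q → q < a) (fun N => by
    refine (eventually_all_finite (finite_weight_le N)).2 fun u _ => ?_
    obtain ⟨b, hb⟩ := (hB (Encodable.encode u)).bddAbove
    filter_upwards [eventually_gt_atTop b] with a ha hu q hqB hq
    exact (hb ⟨⟨u, rfl, hu, hq⟩, hqB⟩).trans_lt ha)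
  obtain ⟨A', hle, hinf, Z, hS⟩ := exists_isSparse hA hF s p
  have key : ∀ x ∈ branchesFrom s A', ∀ q ∉ B, f x q ≠ F s q →
      ∃ i, s.length ≤ i ∧ q < p (x i) ∧ ∀ M ∈ Z, M < x i → p M ≤ q := by
    intro x hx q hqB hq
    have hex : ∃ i, s.length ≤ i ∧ q < p (x i) := by
      obtain ⟨i, hi, hqi⟩ := hS.exists_le hx (q + 1)
      exact ⟨i, hi, lt_of_lt_of_le hqi (hp _).1⟩
    obtain ⟨hi, hqi⟩ := Nat.find_spec hex
    have hmin : ∀ j, s.length ≤ j → j < Nat.find hex → p (x j) ≤ q := fun j hj hji =>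
      not_lt.1 fun hc => Nat.find_min hex hji ⟨hj, hc⟩
    generalize Nat.find hex = i at hi hqi hmin
    refine ⟨i, hi, hqi, fun M hM hMx => ?_⟩
    by_contra! hqM
    have hwM : weight (seg x i) ≤ M := hS.weight_seg_le hx hi hM fun j hj hji =>
      not_lt.1 fun hc => (hqM.trans_le (hpmono hc.le)).not_ge (hmin j hj hji)
    rw [hS.agree hx hi hM hwM hMx q hqM] at hq
    rcases hi.eq_or_lt with rfl | hi'
    · exact hq (by rw [hx.1])
    · obtain ⟨i, rfl⟩ : ∃ i', i = i' + 1 := ⟨i - 1, by omega⟩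
      have := (hp (x i)).2 _ (hS.weight_le hx (by omega))
        (hconst x (branchesFrom_mono hle hx) _ hi) q hqB hq
      exact this.not_ge (hmin i (by omega) (by omega))
  refine ⟨A', hle, hinf, fun x hx y hy hxy hE => hne x (branchesFrom_mono hle hx) ?_⟩
  obtain ⟨d, hd⟩ := Function.ne_iff.1 hxy
  have hfin : {q | q ∉ B ∧ f x q ≠ F s q ∧ f y q ≠ F s q}.Finite := by
    refine ((finite_Iic d).biUnion fun i _ => finite_Iio (p (x i))).subset ?_
    rintro q ⟨hqB, hqx, hqy⟩
    obtain ⟨i, hi, hqi, hi'⟩ := key x hx q hqB hqx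
    obtain ⟨j, hj, hqj, hj'⟩ := key y hy q hqB hqy
    have hij : x i = y j := by
      rcases lt_trichotomy (x i) (y j) with hc | hc | hc
      · exact absurd hqi (hj' _ (hS.mem hx hi) hc).not_gt
      · exact hc
      · exact absurd hqj (hi' _ (hS.mem hy hj) hc).not_gt
    have hseg := (hS.eq hx hy hi hj hij).2
    have hid : i ≤ d := not_lt.1 fun hc => hd (seg_eq_seg_iff.1 hseg d hc)
    exact mem_biUnion (mem_Iic.2 hid) hqi
  refine hI.2.1 _ _ ?_ (hI.2.2.1 _ _ (hI.2.2.1 _ _ hE hBI) (hI.1 _ hfin))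
  intro q hq
  by_cases hqB : q ∈ B
  · exact Or.inl (Or.inr hqB)
  · by_cases hqy : f y q = F s q
    · exact Or.inl (Or.inl fun hc => hq (hc.trans hqy))
    · exact Or.inr ⟨hqB, hq, hqy⟩

theorem exists_canonical_branchesFrom {I : Set (Set ℕ)} (hI : IsIdeal I) (hP : IsPIdeal I)
    (hFs : FsigmaIdeal I) {f : (ℕ → ℕ) → ℕ → Bool} (hf : Measurable f) (s : List ℕ)
    {A : List ℕ → Set ℕ} (hA : ∀ u, (A u).Infinite) :
    ∃ t A', (∀ u, (A' u).Infinite) ∧ branchesFrom t A' ⊆ branchesFrom s A ∧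
      ((∀ x ∈ branchesFrom t A', ∀ y ∈ branchesFrom t A', x ≠ y → ¬ EI I (f x) (f y)) ∨
        ∀ x ∈ branchesFrom t A', ∀ y ∈ branchesFrom t A', EI I (f x) (f y)) := by
  obtain ⟨A₁, h₁A, h₁, F, h, hF⟩ := exists_limits hf hA
  let C : ℕ → Set (ℕ → ℕ) := fun k =>
    {x | ∀ j, k ≤ j → EI I (F (seg x j)) (F (seg x (j + 1)))}
  have hC : ∀ k, MeasurableSet (C k) := by
    intro k
    simp only [C, ofPred_forall]
    refine MeasurableSet.iInter fun j => MeasurableSet.iInter fun _ => ?_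
    convert measurableSet_seg (fun l => EI I (F (l.take j)) (F l)) (j + 1) using 3 with x
    rw [take_seg x (Nat.le_succ j)]
  obtain ⟨A₂, h₂₁, h₂, hdec⟩ := exists_fusion
    (P := fun t X => X ⊆ C t.length ∨ X ⊆ (C t.length)ᶜ)
    (fun t X Y hXY h => h.imp hXY.trans hXY.trans)
    (fun t A hA => (hC _).purelyDecided t A hA) h₁
  have hF₂ : ∀ t, ∀ x ∈ branchesFrom t A₂, ∀ a, h t a ≤ x t.length → ∀ q < a, f x q = F t q :=
    fun t x hx => hF t x (branchesFrom_mono h₂₁ hx)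
  by_cases hcase : ∀ x ∈ branchesFrom s A₂, ∀ k, s.length ≤ k → x ∉ C k
  · obtain ⟨A₃, h₃₂, h₃, hne⟩ := exists_pairwise_not_EI_of_change hI hFs h₂ hF₂ s
      fun x hx k hk => by simpa [C] using hcase x hx k hk
    exact ⟨s, A₃, h₃, branchesFrom_mono (h₃₂.trans (h₂₁.trans h₁A)), Or.inl hne⟩
  push Not at hcase
  obtain ⟨x₀, hx₀, k, hk, hxC⟩ := hcase
  set t := seg x₀ k
  have htlen : t.length = k := length_seg x₀ k
  have hts : branchesFrom t A₂ ⊆ branchesFrom s A :=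
    (branchesFrom_seg_subset hx₀ hk).trans (branchesFrom_mono (h₂₁.trans h₁A))
  have htC : branchesFrom t A₂ ⊆ C t.length :=
    (hdec t).resolve_right fun hc => hc (mem_branchesFrom_seg hx₀ hk) (htlen.symm ▸ hxC)
  have hconst : ∀ x ∈ branchesFrom t A₂, ∀ j, t.length ≤ j → EI I (F (seg x j)) (F t) := by
    intro x hx j hj
    induction j, hj using Nat.le_induction with
    | base => rw [hx.1]; exact EI.refl hI _
    | succ j hj ih => exact (htC hx j hj).symm.trans hI ih
  obtain ⟨A₃, h₃₂, h₃, hB | hB⟩ := (hFs.measurableSet_EI hf (F t)).purelyDecided t A₂ h₂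
  · exact ⟨t, A₃, h₃, (branchesFrom_mono h₃₂).trans hts,
      Or.inr fun x hx y hy => (hB hx).trans hI (hB hy).symm⟩
  · obtain ⟨A₄, h₄₃, h₄, hne⟩ := exists_pairwise_not_EI_of_const hI hP h₃
      (fun u x hx => hF₂ u x (branchesFrom_mono h₃₂ hx)) t
      (fun x hx => hconst x (branchesFrom_mono h₃₂ hx)) hB
    exact ⟨t, A₄, h₄, (branchesFrom_mono (h₄₃.trans h₃₂)).trans hts, Or.inl hne⟩

theorem IsLaverTree.exists_branchesFrom_subset {T : Set (List ℕ)} (hT : IsLaverTree T) :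
    ∃ s A, (∀ u, (A u).Infinite) ∧ branchesFrom s A ⊆ branches T := by
  obtain ⟨hcl, s, hs, -, hinf⟩ := hT
  refine ⟨s, fun t => {n | t ∈ T → s <+: t → t ++ [n] ∈ T}, fun t => ?_, ?_⟩
  · by_cases ht : t ∈ T ∧ s <+: t
    · simpa [ht.1, ht.2] using hinf t ht.1 ht.2
    · convert infinite_univ (α := ℕ)
      ext n
      simpa using fun h1 h2 => absurd ⟨h1, h2⟩ ht
  · rintro x ⟨hx, hx'⟩
    have hmem : ∀ i, s.length ≤ i → seg x i ∈ T := by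
      intro i hi
      induction i, hi using Nat.le_induction with
      | base => rwa [hx]
      | succ i hi ih =>
        rw [seg_succ]
        exact hx' i hi ih (by simpa only [hx] using seg_prefix_seg x hi)
    exact fun n => hcl _ (hmem (max s.length n) (le_max_left _ _)) _
      (seg_prefix_seg x (le_max_right _ _))

theorem exists_isLaverTree_branches_subset {T : Set (List ℕ)} {s : List ℕ}
    {A : List ℕ → Set ℕ} (hA : ∀ u, (A u).Infinite) (hT : branchesFrom s A ⊆ branches T) :
    ∃ S, IsLaverTree S ∧ S ⊆ T ∧ branches S ⊆ branchesFrom s A := by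
  refine ⟨{t | ∃ x ∈ branchesFrom s A, ∃ n, t = seg x n}, ⟨?_, s, ?_, ?_, ?_⟩, ?_, ?_⟩
  · rintro _ ⟨x, hx, n, rfl⟩ t ht
    exact ⟨x, hx, _, eq_seg_of_isPrefix ht⟩
  · obtain ⟨x, hx⟩ := branchesFrom_nonempty s hA
    exact ⟨x, hx, _, hx.1.symm⟩
  · rintro _ ⟨x, hx, n, rfl⟩
    rw [← hx.1]
    exact (le_total n s.length).imp (seg_prefix_seg x) (seg_prefix_seg x)
  · rintro _ ⟨x, hx, n, rfl⟩ hs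
    have hn : s.length ≤ n := by simpa [length_seg] using hs.length_le
    refine (hA (seg x n)).mono fun m hm => ?_
    obtain ⟨y, hy⟩ := branchesFrom_nonempty (seg x n ++ [m]) hA
    have hyseg : seg y (n + 1) = seg x n ++ [m] := by
      simpa only [List.length_append, length_seg, List.length_singleton] using hy.1
    refine ⟨y, branchesFrom_seg_subset hx hn ⟨?_, fun i hi => ?_⟩, n + 1, hyseg.symm⟩
    · rw [length_seg, ← take_seg y (Nat.le_succ n), hyseg,
        List.take_left' (length_seg x n)]
    · rw [length_seg] at hi
      rcases hi.eq_or_lt with rfl | hi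
      · rw [seg_succ] at hyseg
        obtain ⟨h1, h2⟩ := List.append_inj hyseg (by rw [length_seg, length_seg])
        rw [h1, List.singleton_inj.1 h2]
        exact hm
      · exact hy.2 i (by simpa [length_seg] using hi)
  · rintro _ ⟨x, hx, n, rfl⟩
    exact hT hx n
  · intro x hx
    have hx' : ∀ n, ∃ y ∈ branchesFrom s A, seg x n = seg y n := by
      intro n
      obtain ⟨y, hy, k, hk⟩ := hx n
      have : n = k := by simpa [length_seg] using congrArg List.length hk
      exact ⟨y, hy, this ▸ hk⟩
    refine ⟨?_, fun i hi => ?_⟩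
    · obtain ⟨y, hy, h⟩ := hx' s.length
      rw [h, hy.1]
    · obtain ⟨y, hy, h⟩ := hx' (i + 1)
      rw [seg_eq_seg_iff] at h
      rw [h i (Nat.lt_succ_self i), seg_eq_seg_iff.2 fun j hj => h j (hj.trans i.lt_succ_self)]
      exact hy.2 i hi

/-- canonization of equivalences Borel reducible to `E_I`, `I` an
F_σ P-ideal, on Laver trees. -/
theorem stmt0 (T : Set (List ℕ)) (hT : IsLaverTree T)
    (I : Set (Set ℕ)) (hI : IsIdeal I) (hP : IsPIdeal I) (hF : FsigmaIdeal I)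
    (E : Set ((ℕ → ℕ) × (ℕ → ℕ))) (hEborel : MeasurableSet E)
    (hEsub : E ⊆ (branches T) ×ˢ (branches T))
    (hrefl : ∀ x ∈ branches T, (x, x) ∈ E)
    (hsymm : ∀ x y, (x, y) ∈ E → (y, x) ∈ E)
    (htrans : ∀ x y z, (x, y) ∈ E → (y, z) ∈ E → (x, z) ∈ E)
    (f : (ℕ → ℕ) → (ℕ → Bool)) (hf : Measurable f)
    (hred : ∀ x ∈ branches T, ∀ y ∈ branches T, ((x, y) ∈ E ↔ EI I (f x) (f y))) :
    ∃ S, IsLaverTree S ∧ S ⊆ T ∧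
      ((∀ x ∈ branches S, ∀ y ∈ branches S, ((x, y) ∈ E ↔ x = y)) ∨
        (∀ x ∈ branches S, ∀ y ∈ branches S, (x, y) ∈ E)) := by
  obtain ⟨s, A, hA, hAT⟩ := hT.exists_branchesFrom_subset
  obtain ⟨t, A', hA', hsub, hcan⟩ := exists_canonical_branchesFrom hI hP hF hf s hA
  obtain ⟨S, hS, hST, hSb⟩ := exists_isLaverTree_branches_subset hA' (hsub.trans hAT)
  have hSB : branches S ⊆ branches T := fun x hx n => hST (hx n)
  refine ⟨S, hS, hST, hcan.imp (fun h x hx y hy => ⟨fun hxy => ?_, ?_⟩) fun h x hx y hy => ?_⟩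
  · by_contra hne
    exact h x (hSb hx) y (hSb hy) hne ((hred x (hSB hx) y (hSB hy)).1 hxy)
  · rintro rfl
    exact hrefl x (hSB hx)
  · exact (hred x (hSB hx) y (hSB hy)).2 (h x (hSb hx) y (hSb hy))
end

section
/- For every F_σ P-ideal I on ℕ there exists a lower semicontinuous submeasure μ on ℕ such that I = Exh(μ) = Fin(μ). -/
open Set Filter

section CofinalFamilies

/-- `Y` is cofinal in `J` with respect to almost inclusion. -/
def AlmostCofinal (J Y : Set (ℕ → Bool)) : Prop :=
  ∀ a ∈ J, ∃ y ∈ Y, a ≤ᶠ[atTop] y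

/-- Every countable subset of `J` has an almost upper bound in `J`. -/
def AlmostSigmaDirected (J : Set (ℕ → Bool)) : Prop :=
  ∀ a : ℕ → ℕ → Bool, (∀ n, a n ∈ J) → ∃ b ∈ J, ∀ n, a n ≤ᶠ[atTop] b

/-- The sequence `x` with its first `n` values replaced by `false`. -/
def cutBelow (n : ℕ) (x : ℕ → Bool) : ℕ → Bool := fun i => decide (n ≤ i) && x i

lemma cutBelow_le (n : ℕ) (x : ℕ → Bool) : cutBelow n x ≤ x := by
  intro i
  simp only [cutBelow]
  cases decide (n ≤ i) <;> simp

lemma cutBelow_mono (n : ℕ) {x y : ℕ → Bool} (h : x ≤ y) : cutBelow n x ≤ cutBelow n y := by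
  intro i
  have := h i
  simp only [cutBelow]
  cases decide (n ≤ i) <;> simp_all

lemma eventuallyLE_cutBelow (n : ℕ) (x : ℕ → Bool) : x ≤ᶠ[atTop] cutBelow n x := by
  filter_upwards [eventually_ge_atTop n] with i hi
  simp [cutBelow, hi]

lemma cutBelow_sup (n : ℕ) (x y : ℕ → Bool) :
    cutBelow n (x ⊔ y) = cutBelow n x ⊔ cutBelow n y := by
  ext i
  simp only [cutBelow, Pi.sup_apply]
  cases decide (n ≤ i) <;> simp

lemma cutBelow_of_forall_lt {n : ℕ} {x : ℕ → Bool} (h : ∀ i < n, x i = false) :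
    cutBelow n x = x := by
  ext i
  by_cases hi : n ≤ i
  · simp [cutBelow, hi]
  · simp [cutBelow, hi, h i (not_le.1 hi)]

lemma exists_cutBelow_le {x y : ℕ → Bool} (h : x ≤ᶠ[atTop] y) : ∃ n, cutBelow n x ≤ y := by
  obtain ⟨n, hn⟩ := eventually_atTop.1 h
  refine ⟨n, fun i => ?_⟩
  by_cases hi : n ≤ i
  · simpa [cutBelow, hi] using hn i hi
  · simp [cutBelow, hi]

lemma continuous_cutBelow (n : ℕ) : Continuous (cutBelow n) :=
  continuous_pi fun i =>
    (continuous_of_discreteTopology (f := fun b : Bool => decide (n ≤ i) && b)).comp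
      (continuous_apply i)

lemma continuous_bool_sup {X : Type*} [TopologicalSpace X] {f g : X → ℕ → Bool}
    (hf : Continuous f) (hg : Continuous g) : Continuous fun x => f x ⊔ g x :=
  continuous_pi fun i =>
    (continuous_of_discreteTopology (f := fun b : Bool × Bool => b.1 ⊔ b.2)).comp
      (((continuous_apply i).comp hf).prodMk ((continuous_apply i).comp hg))

lemma isClosed_coe_lowerClosure {K : Set (ℕ → Bool)} (hK : IsClosed K) :
    IsClosed (lowerClosure K : Set (ℕ → Bool)) := by
  have hle : IsClosed {p : (ℕ → Bool) × (ℕ → Bool) | p.1 ≤ p.2} := by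
    have : {p : (ℕ → Bool) × (ℕ → Bool) | p.1 ≤ p.2} =
        ⋂ i, (fun p : (ℕ → Bool) × (ℕ → Bool) => (p.1 i, p.2 i)) ⁻¹' {b | b.1 ≤ b.2} := by
      ext p
      simp [Pi.le_def]
    rw [this]
    exact isClosed_iInter fun i => (isClosed_discrete _).preimage (by fun_prop)
  have himg : (lowerClosure K : Set (ℕ → Bool)) =
      Prod.fst '' ({p : (ℕ → Bool) × (ℕ → Bool) | p.1 ≤ p.2} ∩ Prod.snd ⁻¹' K) := by
    ext x
    simp only [SetLike.mem_coe, mem_lowerClosure, mem_image, mem_inter_iff, mem_ofPred_eq,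
      mem_preimage, Prod.exists, exists_and_right, exists_eq_right]
    exact exists_congr fun y => and_comm
  rw [himg]
  exact ((hle.inter (hK.preimage continuous_snd)).isCompact.image continuous_fst).isClosed

lemma AlmostCofinal.mono {J Y Z : Set (ℕ → Bool)} (hY : AlmostCofinal J Y) (h : Y ⊆ Z) :
    AlmostCofinal J Z := fun a ha =>
  let ⟨y, hy, hay⟩ := hY a ha
  ⟨y, h hy, hay⟩

lemma AlmostSigmaDirected.exists_almostCofinal {J : Set (ℕ → Bool)}
    (hJ : AlmostSigmaDirected J) {ι : Type*} [Countable ι] [Nonempty ι]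
    {Y : ι → Set (ℕ → Bool)} (h : AlmostCofinal J (⋃ i, Y i)) :
    ∃ i, AlmostCofinal J (Y i) := by
  by_contra! hn
  have hn' : ∀ i, ∃ a ∈ J, ∀ y ∈ Y i, ¬ a ≤ᶠ[atTop] y := by
    intro i
    simpa [AlmostCofinal] using hn i
  choose a haJ ha using hn'
  obtain ⟨e, he⟩ := exists_surjective_nat ι
  obtain ⟨b, hbJ, hb⟩ := hJ (fun n => a (e n)) fun n => haJ _
  obtain ⟨y, hy, hby⟩ := h b hbJ
  obtain ⟨i, hi⟩ := mem_iUnion.1 hy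
  obtain ⟨n, rfl⟩ := he i
  exact ha _ y hi ((hb n).trans hby)

/-- The points of `C` all of whose basic neighbourhoods have almost cofinal trace on `C`. -/
def cofinalKernel (J C : Set (ℕ → Bool)) : Set (ℕ → Bool) :=
  C \ ⋃₀ {U ∈ TopologicalSpace.countableBasis (ℕ → Bool) | ¬ AlmostCofinal J (C ∩ U)}

lemma isClosed_cofinalKernel {J C : Set (ℕ → Bool)} (hC : IsClosed C) :
    IsClosed (cofinalKernel J C) :=
  hC.sdiff (isOpen_sUnion fun _ hU => TopologicalSpace.isOpen_of_mem_countableBasis hU.1)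

lemma almostCofinal_cofinalKernel_inter {J C W : Set (ℕ → Bool)} (hJ : AlmostSigmaDirected J)
    (h : AlmostCofinal J (C ∩ W)) : AlmostCofinal J (cofinalKernel J C ∩ W) := by
  let B := {U ∈ TopologicalSpace.countableBasis (ℕ → Bool) | ¬ AlmostCofinal J (C ∩ U)}
  have : Countable B :=
    ((TopologicalSpace.countable_countableBasis _).mono fun _ hU => hU.1).to_subtype
  let Y : Option B → Set (ℕ → Bool) := fun o => o.elim (cofinalKernel J C ∩ W) fun U => C ∩ U
  have hY : AlmostCofinal J (⋃ o, Y o) := by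
    refine h.mono fun x hx => mem_iUnion.2 ?_
    by_cases hxB : x ∈ ⋃₀ B
    · obtain ⟨U, hU, hxU⟩ := hxB
      exact ⟨some ⟨U, hU⟩, hx.1, hxU⟩
    · exact ⟨none, ⟨hx.1, hxB⟩, hx.2⟩
  obtain ⟨_ | U, ho⟩ := hJ.exists_almostCofinal hY
  · exact ho
  · exact absurd ho U.2.2

lemma almostCofinal_cofinalKernel_inter_of_isOpen {J C U : Set (ℕ → Bool)}
    (hJ : AlmostSigmaDirected J) (hU : IsOpen U) {x : ℕ → Bool} (hx : x ∈ cofinalKernel J C)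
    (hxU : x ∈ U) : AlmostCofinal J (cofinalKernel J C ∩ U) := by
  obtain ⟨V, hV, hxV, hVU⟩ :=
    (TopologicalSpace.isBasis_countableBasis (ℕ → Bool)).exists_subset_of_mem_open hxU hU
  have hCV : AlmostCofinal J (C ∩ V) := by
    by_contra hn
    exact hx.2 ⟨V, ⟨hV, hn⟩, hxV⟩
  exact (almostCofinal_cofinalKernel_inter hJ hCV).mono (inter_subset_inter_right _ hVU)

/-- By Baire category, some truncation of unions of members of two open parts of the
kernel of `C` stays in `C`. -/
lemma exists_cutBelow_sup_mem {J C : Set (ℕ → Bool)} (hJ : AlmostSigmaDirected J)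
    (hne : J.Nonempty) (hsup : ∀ x ∈ J, ∀ y ∈ J, x ⊔ y ∈ J) (hCJ : C ⊆ J) (hC : IsClosed C)
    (hlow : IsLowerSet C) (hcof : AlmostCofinal J C) :
    ∃ (n : ℕ) (Y Z : Set (ℕ → Bool)), AlmostCofinal J Y ∧ AlmostCofinal J Z ∧
      ∀ y ∈ Y, ∀ z ∈ Z, cutBelow n (y ⊔ z) ∈ C := by
  set E := cofinalKernel J C with hE
  have hEC : E ⊆ C := sdiff_subset
  have : CompactSpace E :=
    isCompact_iff_compactSpace.1 (isClosed_cofinalKernel (J := J) hC).isCompact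
  obtain ⟨a, ha⟩ := hne
  have : Nonempty E := by
    obtain ⟨y, hy, -⟩ := almostCofinal_cofinalKernel_inter (W := univ) hJ (by simpa using hcof) a ha
    exact ⟨⟨y, hy.1⟩⟩
  let f : ℕ → Set (E × E) := fun n => {p | cutBelow n (p.1.1 ⊔ p.2.1) ∈ C}
  have hf : ∀ n, IsClosed (f n) := fun n =>
    hC.preimage ((continuous_cutBelow n).comp (continuous_bool_sup
      (continuous_subtype_val.comp continuous_fst) (continuous_subtype_val.comp continuous_snd)))
  have hfU : ⋃ n, f n = univ := by
    refine eq_univ_of_forall fun p => mem_iUnion.2 ?_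
    obtain ⟨y, hy, hle⟩ := hcof _ (hsup _ (hCJ (hEC p.1.2)) _ (hCJ (hEC p.2.2)))
    obtain ⟨n, hn⟩ := exists_cutBelow_le hle
    exact ⟨n, hlow hn hy⟩
  obtain ⟨n, ⟨y, z⟩, hyz⟩ := nonempty_interior_of_iUnion_of_closed hf hfU
  obtain ⟨u, v, hu, hv, hyu, hzv, huv⟩ := isOpen_prod_iff.1 isOpen_interior y z hyz
  obtain ⟨U, hU, rfl⟩ := isOpen_induced_iff.1 hu
  obtain ⟨V, hV, rfl⟩ := isOpen_induced_iff.1 hv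
  refine ⟨n, E ∩ U, E ∩ V, almostCofinal_cofinalKernel_inter_of_isOpen hJ hU y.2 hyu,
    almostCofinal_cofinalKernel_inter_of_isOpen hJ hV z.2 hzv, fun y' hy' z' hz' => ?_⟩
  have hmem : ((⟨y', hy'.1⟩, ⟨z', hz'.1⟩) : E × E) ∈ f n :=
    interior_subset (huv ⟨hy'.2, hz'.2⟩)
  exact hmem

/-- A closed lower almost cofinal subfamily of `J`. -/
structure IsAbsorbing (J C : Set (ℕ → Bool)) : Prop where
  subset : C ⊆ J
  isClosed : IsClosed C
  isLowerSet : IsLowerSet C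
  cofinal : AlmostCofinal J C

lemma IsAbsorbing.exists_sup_mem {J C : Set (ℕ → Bool)} (hJ : AlmostSigmaDirected J)
    (hne : J.Nonempty) (hsup : ∀ x ∈ J, ∀ y ∈ J, x ⊔ y ∈ J) (hC : IsAbsorbing J C) :
    ∃ D, IsAbsorbing J D ∧ ∀ x ∈ D, ∀ y ∈ D, x ⊔ y ∈ C := by
  obtain ⟨n, Y, Z, hY, hZ, hYZ⟩ :=
    exists_cutBelow_sup_mem hJ hne hsup hC.subset hC.isClosed hC.isLowerSet hC.cofinal
  let D₁ := {x | ∀ z ∈ Z, cutBelow n (x ⊔ z) ∈ C}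
  let D₂ := {x | ∀ y ∈ D₁, cutBelow n (y ⊔ x) ∈ C}
  let D := {x : ℕ → Bool | ∀ i < n, x i = false} ∩ (D₁ ∩ D₂)
  have hD : ∀ x ∈ D, ∀ y ∈ D, x ⊔ y ∈ C := by
    intro x hx y hy
    have h := hy.2.2 x hx.2.1
    rwa [cutBelow_of_forall_lt] at h
    intro i hi
    simp [hx.1 i hi, hy.1 i hi]
  have hlow₁ : IsLowerSet D₁ := fun x y hyx hx z hz =>
    hC.isLowerSet (cutBelow_mono n (sup_le_sup_right hyx z)) (hx z hz)
  have hlow₂ : IsLowerSet D₂ := fun x y hyx hx z hz =>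
    hC.isLowerSet (cutBelow_mono n (sup_le_sup_left hyx z)) (hx z hz)
  refine ⟨D, ⟨?_, ?_, ?_, ?_⟩, hD⟩
  · intro x hx
    simpa using hC.subset (hD x hx x hx)
  · refine IsClosed.inter ?_ (IsClosed.inter ?_ ?_)
    · simp only [ofPred_forall]
      exact isClosed_iInter fun i => isClosed_iInter fun _ =>
        isClosed_eq (continuous_apply i) continuous_const
    · simp only [D₁, ofPred_forall]
      exact isClosed_iInter fun z => isClosed_iInter fun _ => hC.isClosed.preimage
        ((continuous_cutBelow n).comp (continuous_bool_sup continuous_id continuous_const))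
    · simp only [D₂, ofPred_forall]
      exact isClosed_iInter fun z => isClosed_iInter fun _ => hC.isClosed.preimage
        ((continuous_cutBelow n).comp (continuous_bool_sup continuous_const continuous_id))
  · refine IsLowerSet.inter ?_ (hlow₁.inter hlow₂)
    intro x y hyx hx i hi
    have := hyx i
    rw [hx i hi] at this
    exact le_bot_iff.1 this
  · intro a ha
    obtain ⟨y, hy, hay⟩ := hY a ha
    obtain ⟨z, hz, haz⟩ := hZ a ha
    have hzD : z ∈ D₂ := fun w hw => hw z hz
    refine ⟨cutBelow n (y ⊓ z), ⟨fun i hi => by simp [cutBelow, hi], ?_, ?_⟩, ?_⟩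
    · exact hlow₁ ((cutBelow_le _ _).trans inf_le_left) (hYZ y hy)
    · exact hlow₂ ((cutBelow_le _ _).trans inf_le_right) hzD
    · have h : a ≤ᶠ[atTop] y ⊓ z := by
        filter_upwards [hay, haz] with i h₁ h₂ using le_inf h₁ h₂
      exact h.trans (eventuallyLE_cutBelow _ _)

/-- Mazur's increasing sequence of closed lower families associated with closed families `F`. -/
def mazurSeq (F : ℕ → Set (ℕ → Bool)) : ℕ → Set (ℕ → Bool)
  | 0 => lowerClosure (F 0)
  | n + 1 => lowerClosure
      ((fun p : (ℕ → Bool) × (ℕ → Bool) => p.1 ⊔ p.2) '' (mazurSeq F n ×ˢ mazurSeq F n) ∪ F (n + 1))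

lemma isLowerSet_mazurSeq (F : ℕ → Set (ℕ → Bool)) (n : ℕ) : IsLowerSet (mazurSeq F n) := by
  cases n <;> exact (lowerClosure _).lower

lemma isClosed_mazurSeq {F : ℕ → Set (ℕ → Bool)} (hF : ∀ n, IsClosed (F n)) (n : ℕ) :
    IsClosed (mazurSeq F n) := by
  induction n with
  | zero => exact isClosed_coe_lowerClosure (hF 0)
  | succ n ih =>
    exact isClosed_coe_lowerClosure (((ih.isCompact.prod ih.isCompact).image
      (continuous_bool_sup continuous_fst continuous_snd)).isClosed.union (hF _))

lemma subset_mazurSeq (F : ℕ → Set (ℕ → Bool)) (n : ℕ) : F n ⊆ mazurSeq F n := by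
  cases n
  · exact subset_lowerClosure
  · exact subset_union_right.trans subset_lowerClosure

lemma sup_mem_mazurSeq_succ {F : ℕ → Set (ℕ → Bool)} {n : ℕ} {x y : ℕ → Bool}
    (hx : x ∈ mazurSeq F n) (hy : y ∈ mazurSeq F n) : x ⊔ y ∈ mazurSeq F (n + 1) :=
  subset_lowerClosure (Or.inl ⟨(x, y), ⟨hx, hy⟩, rfl⟩)

lemma mazurSeq_subset {F : ℕ → Set (ℕ → Bool)} {J : Set (ℕ → Bool)} (hlow : IsLowerSet J)
    (hsup : ∀ x ∈ J, ∀ y ∈ J, x ⊔ y ∈ J) (hF : ∀ n, F n ⊆ J) (n : ℕ) : mazurSeq F n ⊆ J := by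
  induction n with
  | zero => exact lowerClosure_min (hF 0) hlow
  | succ n ih =>
    refine lowerClosure_min (union_subset ?_ (hF _)) hlow
    rintro _ ⟨p, hp, rfl⟩
    exact hsup _ (ih hp.1) _ (ih hp.2)

/-- Scale of absorbing families exhausting `J`. -/
lemma exists_absorbing_scale {J : Set (ℕ → Bool)} (hJ : AlmostSigmaDirected J)
    (hne : J.Nonempty) (hlow : IsLowerSet J) (hsup : ∀ x ∈ J, ∀ y ∈ J, x ⊔ y ∈ J)
    (hF : IsFsigma J) :
    ∃ C : ℤ → Set (ℕ → Bool), (∀ k, IsAbsorbing J (C k)) ∧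
      (∀ k, ∀ x ∈ C k, ∀ y ∈ C k, x ⊔ y ∈ C (k + 1)) ∧ J ⊆ ⋃ k, C k := by
  obtain ⟨F, hFc, hJF⟩ := hF
  have hsub := mazurSeq_subset hlow hsup fun n => (subset_iUnion F n).trans_eq hJF.symm
  have hmono : Monotone (mazurSeq F) := monotone_nat_of_le_succ fun n x hx => by
    simpa using sup_mem_mazurSeq_succ hx hx
  have hcov : J ⊆ ⋃ n, mazurSeq F n := hJF.trans_subset (iUnion_mono (subset_mazurSeq F))
  obtain ⟨N, hN⟩ := hJ.exists_almostCofinal (Y := mazurSeq F) fun a ha =>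
    ⟨a, hcov ha, Filter.EventuallyLE.refl _ _⟩
  have hU : ∀ n, IsAbsorbing J (mazurSeq F (N + n)) := fun n =>
    ⟨hsub _, isClosed_mazurSeq hFc _, isLowerSet_mazurSeq F _, hN.mono (hmono (by omega))⟩
  choose D hD hDsup using fun C : {C // IsAbsorbing J C} => C.2.exists_sup_mem hJ hne hsup
  let V : ℕ → {C // IsAbsorbing J C} := fun n =>
    Nat.rec ⟨mazurSeq F N, hU 0⟩ (fun _ C => ⟨D C, hD C⟩) n
  let C : ℤ → Set (ℕ → Bool)
    | Int.ofNat n => mazurSeq F (N + n)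
    | Int.negSucc n => (V (n + 1)).1
  refine ⟨C, ?_, ?_, ?_⟩
  · rintro (n | n)
    · exact hU n
    · exact (V (n + 1)).2
  · rintro (n | _ | n) x hx y hy
    · exact sup_mem_mazurSeq_succ hx hy
    · exact hDsup (V 0) x hx y hy
    · exact hDsup (V (n + 1)) x hx y hy
  · intro x hx
    obtain ⟨n, hn⟩ := mem_iUnion.1 (hcov hx)
    exact mem_iUnion.2 ⟨Int.ofNat n, hmono (by omega) hn⟩

end CofinalFamilies

section ScaleSubmeasure

open scoped ENNReal

/-- The gauge of a scale of families of sets, with values in the powers of two. -/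
noncomputable def scaleGauge (C : ℤ → Set (Set ℕ)) (A : Set ℕ) : ℝ≥0∞ :=
  ⨅ (k : ℤ) (_ : A ∈ C k), (2 : ℝ≥0∞) ^ k

lemma scaleGauge_le {C : ℤ → Set (Set ℕ)} {A : Set ℕ} {k : ℤ} (h : A ∈ C k) :
    scaleGauge C A ≤ (2 : ℝ≥0∞) ^ k := iInf₂_le k h

lemma two_zpow_strictMono : StrictMono fun k : ℤ => (2 : ℝ≥0∞) ^ k := by
  refine strictMono_int_of_lt_succ fun k => ?_
  rw [ENNReal.zpow_add (by simp) (by simp), zpow_one, mul_two]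
  exact ENNReal.lt_add_right (ENNReal.zpow_ne_top (by simp) (by simp) _)
    (ENNReal.zpow_pos (by simp) (by simp) _).ne'

lemma tendsto_two_zpow_neg : Tendsto (fun n : ℕ => (2 : ℝ≥0∞) ^ (-(n : ℤ))) atTop (nhds 0) := by
  have h := ENNReal.tendsto_pow_atTop_nhds_zero_of_lt_one (r := 2⁻¹) (by simp)
  refine h.congr fun n => ?_
  rw [ENNReal.zpow_neg, zpow_natCast, ENNReal.inv_pow]

/-- A scale of lower families of sets, each closed under finite approximation. -/
structure IsScale (C : ℤ → Set (Set ℕ)) : Prop where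
  empty_mem : ∀ k, ∅ ∈ C k
  mem_of_subset : ∀ k A B, A ⊆ B → B ∈ C k → A ∈ C k
  union_mem : ∀ k, ∀ A ∈ C k, ∀ B ∈ C k, ∀ D ∈ C k, A ∪ B ∪ D ∈ C (k + 1)
  mem_of_forall : ∀ k A, (∀ n : ℕ, A ∩ Iio n ∈ C k) → A ∈ C k

namespace IsScale

variable {C : ℤ → Set (Set ℕ)}

lemma monotone (hC : IsScale C) : Monotone C :=
  monotone_int_of_le_succ fun k A hA => by simpa using hC.union_mem k A hA A hA A hA

lemma mem_of_scaleGauge_lt (hC : IsScale C) {A : Set ℕ} {k : ℤ}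
    (h : scaleGauge C A < (2 : ℝ≥0∞) ^ (k + 1)) : A ∈ C k := by
  simp only [scaleGauge, iInf_lt_iff] at h
  obtain ⟨j, hj, hlt⟩ := h
  exact hC.monotone (Int.lt_add_one_iff.1 (two_zpow_strictMono.lt_iff_lt.1 hlt)) hj

lemma scaleGauge_empty (hC : IsScale C) : scaleGauge C ∅ = 0 :=
  le_antisymm (ge_of_tendsto' tendsto_two_zpow_neg fun _ => scaleGauge_le (hC.empty_mem _)) bot_le

lemma biUnion_Ico_mem (hC : IsScale C) (A : ℕ → Set ℕ) (d : ℕ) : ∀ (k : ℤ) (p q : ℕ), q - p ≤ d →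
    ∑ i ∈ Finset.Ico p q, scaleGauge C (A i) < (2 : ℝ≥0∞) ^ k →
    ⋃ i ∈ Finset.Ico p q, A i ∈ C k := by
  induction d with
  | zero =>
    intro k p q hd _
    rw [Finset.Ico_eq_empty (by omega)]
    simpa using hC.empty_mem k
  | succ d ih =>
    intro k p q hd hlt
    obtain hqp | hpq := le_or_gt q p
    · rw [Finset.Ico_eq_empty (by omega)]
      simpa using hC.empty_mem k
    obtain ⟨j, rfl⟩ : ∃ j, k = j + 1 := ⟨k - 1, by ring⟩
    have htwo : (2 : ℝ≥0∞) ^ (j + 1) = 2 ^ j + 2 ^ j := by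
      rw [ENNReal.zpow_add (by simp) (by simp), zpow_one, mul_two]
    let P : ℕ → Prop := fun r => ∑ i ∈ Finset.Ico p r, scaleGauge C (A i) < (2 : ℝ≥0∞) ^ j
    have hPp : P p := by simpa [P] using ENNReal.zpow_pos (by simp) (by simp) j
    classical
    obtain ⟨r, hr, hpr, hrq, hmax⟩ : ∃ r, P r ∧ p ≤ r ∧ r < q ∧ (r + 1 < q → ¬ P (r + 1)) := by
      refine ⟨Nat.findGreatest P (q - 1), Nat.findGreatest_spec (by omega) hPp,
        Nat.le_findGreatest (by omega) hPp, ?_, fun h => ?_⟩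
      · have := Nat.findGreatest_le (P := P) (q - 1)
        omega
      · exact Nat.findGreatest_is_greatest (Nat.lt_succ_self _) (by omega)
    have hsum : ∑ i ∈ Finset.Ico p (r + 1), scaleGauge C (A i) +
        ∑ i ∈ Finset.Ico (r + 1) q, scaleGauge C (A i) < (2 : ℝ≥0∞) ^ (j + 1) := by
      rwa [Finset.sum_Ico_consecutive _ (by omega) (by omega)]
    have h₁ := ih j p r (by omega) hr
    have h₂ : A r ∈ C j := by
      refine hC.mem_of_scaleGauge_lt (lt_of_le_of_lt ?_ hlt)
      exact Finset.single_le_sum (f := fun i => scaleGauge C (A i)) (fun _ _ => bot_le)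
        (Finset.mem_Ico.2 ⟨hpr, hrq⟩)
    have h₃ : ⋃ i ∈ Finset.Ico (r + 1) q, A i ∈ C j := by
      refine ih j (r + 1) q (by omega) ?_
      by_cases hlast : r + 1 < q
      · by_contra! hge
        rw [htwo] at hsum
        exact hsum.not_ge (add_le_add (not_lt.1 (hmax hlast)) hge)
      · rw [Finset.Ico_eq_empty (by omega)]
        simpa using ENNReal.zpow_pos (by simp) (by simp) j
    refine hC.mem_of_subset _ _ _ ?_ (hC.union_mem j _ h₁ _ h₂ _ h₃)
    intro x hx
    simp only [mem_iUnion, Finset.mem_Ico, mem_union] at hx ⊢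
    obtain ⟨i, hi, hxi⟩ := hx
    obtain h | rfl | h := lt_trichotomy i r
    · exact Or.inl (Or.inl ⟨i, ⟨hi.1, h⟩, hxi⟩)
    · exact Or.inl (Or.inr hxi)
    · exact Or.inr ⟨i, ⟨h, hi.2⟩, hxi⟩

/-- The outer measure generated by the gauge of a scale. -/
noncomputable def outer (hC : IsScale C) : MeasureTheory.OuterMeasure ℕ :=
  MeasureTheory.OuterMeasure.ofFunction (scaleGauge C) hC.scaleGauge_empty

lemma mem_of_outer_lt (hC : IsScale C) {A : Set ℕ} (hA : A.Finite) {k : ℤ}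
    (h : hC.outer A < (2 : ℝ≥0∞) ^ k) : A ∈ C k := by
  simp only [outer, MeasureTheory.OuterMeasure.ofFunction_apply, iInf_lt_iff] at h
  obtain ⟨t, ht, hlt⟩ := h
  obtain ⟨s, hs, hAs⟩ := finite_subset_iUnion hA ht
  obtain ⟨N, hN⟩ := hs.bddAbove
  refine hC.mem_of_subset _ _ _ ?_ (hC.biUnion_Ico_mem t (N + 1) k 0 (N + 1) (by omega)
    ((ENNReal.sum_le_tsum _).trans_lt hlt))
  intro x hx
  obtain ⟨i, hi, hxi⟩ := mem_iUnion₂.1 (hAs hx)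
  exact mem_iUnion₂.2 ⟨i, by simpa [Nat.lt_succ_iff] using hN hi, hxi⟩

/-- The lower semicontinuous submeasure attached to a scale. -/
noncomputable def submeasure (hC : IsScale C) (A : Set ℕ) : ℝ≥0∞ :=
  ⨆ n : ℕ, hC.outer (A ∩ Iio n)

lemma submeasure_le (hC : IsScale C) {A : Set ℕ} {k : ℤ} (h : A ∈ C k) :
    hC.submeasure A ≤ (2 : ℝ≥0∞) ^ k :=
  iSup_le fun _ => (MeasureTheory.OuterMeasure.ofFunction_le _).trans
    (scaleGauge_le (hC.mem_of_subset _ _ _ inter_subset_left h))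

lemma mem_of_submeasure_lt (hC : IsScale C) {A : Set ℕ} {k : ℤ}
    (h : hC.submeasure A < (2 : ℝ≥0∞) ^ k) : A ∈ C k :=
  hC.mem_of_forall k A fun n => hC.mem_of_outer_lt ((finite_Iio n).inter_of_right A)
    ((le_iSup (fun n : ℕ => hC.outer (A ∩ Iio n)) n).trans_lt h)

lemma isLSCSubmeasure_submeasure (hC : IsScale C) : IsLSCSubmeasure hC.submeasure := by
  refine ⟨by simp [submeasure], fun A B h => ?_, fun A B => ?_, fun A => ?_⟩
  · exact iSup_mono fun n => hC.outer.mono (inter_subset_inter_left _ h)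
  · refine iSup_le fun n => ?_
    rw [union_inter_distrib_right]
    exact (MeasureTheory.measure_union_le _ _).trans (add_le_add
      (le_iSup (fun n : ℕ => hC.outer (A ∩ Iio n)) n)
      (le_iSup (fun n : ℕ => hC.outer (B ∩ Iio n)) n))
  · refine le_antisymm (iSup_mono fun n => ?_) (iSup_le fun n => iSup_mono fun m => ?_)
    · refine le_iSup_of_le n (le_of_eq ?_)
      rw [inter_assoc, inter_self]
    · exact hC.outer.mono (inter_subset_inter_left _ inter_subset_left)

lemma finSub_submeasure (hC : IsScale C) : FinSub hC.submeasure = ⋃ k, C k := by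
  ext A
  simp only [FinSub, mem_ofPred_eq, mem_iUnion]
  refine ⟨fun h => ?_, fun ⟨k, hk⟩ => (hC.submeasure_le hk).trans_lt
    (ENNReal.zpow_ne_top (by simp) (by simp) k).lt_top⟩
  obtain ⟨n, hn⟩ := ENNReal.exists_nat_gt h.ne
  refine ⟨n, hC.mem_of_submeasure_lt (hn.trans ?_)⟩
  rw [zpow_natCast]
  exact_mod_cast Nat.lt_two_pow_self

lemma exh_submeasure (hC : IsScale C) :
    Exh hC.submeasure = {A | ∀ k, ∃ m : ℕ, A \ Iio m ∈ C k} := by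
  ext A
  simp only [Exh, mem_ofPred_eq]
  constructor
  · intro h k
    obtain ⟨m, hm⟩ := (h.eventually_lt_const
      (ENNReal.zpow_pos two_ne_zero ENNReal.ofNat_ne_top k)).exists
    exact ⟨m, hC.mem_of_submeasure_lt hm⟩
  · intro h
    refine ENNReal.tendsto_nhds_zero.2 fun ε hε => ?_
    obtain ⟨n, hn⟩ := (tendsto_two_zpow_neg.eventually_lt_const hε).exists
    obtain ⟨m, hm⟩ := h (-(n : ℤ))
    filter_upwards [eventually_ge_atTop m] with i hi
    exact (hC.submeasure_le (hC.mem_of_subset _ _ _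
      (sdiff_subset_sdiff_right (Iio_subset_Iio hi)) hm)).trans hn.le

end IsScale

end ScaleSubmeasure

section CharacteristicFunctions

lemma chi_apply_eq_true {A : Set ℕ} {i : ℕ} : chi A i = true ↔ i ∈ A := by
  simp [chi]

lemma chi_injective : Function.Injective chi := fun A B h => by
  ext i
  rw [← chi_apply_eq_true, h, chi_apply_eq_true]

lemma chi_setOf_eq_true (x : ℕ → Bool) : chi {i | x i = true} = x := by
  ext i
  rw [Bool.eq_iff_iff, chi_apply_eq_true]
  rfl

lemma chi_le_chi {A B : Set ℕ} (h : A ⊆ B) : chi A ≤ chi B := by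
  intro i
  rw [Bool.le_iff_imp, chi_apply_eq_true, chi_apply_eq_true]
  exact @h i

lemma chi_union (A B : Set ℕ) : chi (A ∪ B) = chi A ⊔ chi B := by
  ext i
  rw [Bool.eq_iff_iff]
  simp [chi_apply_eq_true]

lemma chi_sdiff_Iio (A : Set ℕ) (n : ℕ) : chi (A \ Iio n) = cutBelow n (chi A) := by
  ext i
  rw [Bool.eq_iff_iff]
  simp [cutBelow, chi_apply_eq_true, and_comm]

lemma chi_eventuallyLE {A B : Set ℕ} (h : (A \ B).Finite) : chi A ≤ᶠ[atTop] chi B := by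
  filter_upwards [Nat.cofinite_eq_atTop ▸ h.eventually_cofinite_notMem] with i hi
  rw [Bool.le_iff_imp, chi_apply_eq_true, chi_apply_eq_true]
  exact fun hA => by_contra fun hB => hi ⟨hA, hB⟩

lemma tendsto_chi_inter_Iio (A : Set ℕ) :
    Tendsto (fun n : ℕ => chi (A ∩ Iio n)) atTop (nhds (chi A)) := by
  refine tendsto_pi_nhds.2 fun i => tendsto_const_nhds.congr' ?_
  filter_upwards [eventually_gt_atTop i] with n hn
  rw [Bool.eq_iff_iff]
  simp [chi_apply_eq_true, hn]

lemma IsPIdeal.almostSigmaDirected {I : Set (Set ℕ)} (hP : IsPIdeal I) :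
    AlmostSigmaDirected (chi '' I) := by
  intro a ha
  choose A hA hAa using ha
  obtain ⟨B, hB, hfin⟩ := hP A hA
  exact ⟨chi B, mem_image_of_mem _ hB, fun n => hAa n ▸ chi_eventuallyLE (hfin n)⟩

lemma isLowerSet_chi_image {I : Set (Set ℕ)} (hI : IsIdeal I) : IsLowerSet (chi '' I) := by
  rintro _ x hx ⟨B, hB, rfl⟩
  refine ⟨_, hI.2.1 _ B (fun i hi => ?_) hB, chi_setOf_eq_true x⟩
  exact chi_apply_eq_true.1 (Bool.le_iff_imp.1 (hx i) hi)

lemma isScale_of_isAbsorbing {J : Set (ℕ → Bool)} (hne : J.Nonempty) {C : ℤ → Set (ℕ → Bool)}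
    (hC : ∀ k, IsAbsorbing J (C k)) (hsup : ∀ k, ∀ x ∈ C k, ∀ y ∈ C k, x ⊔ y ∈ C (k + 1)) :
    IsScale fun k => {A | chi A ∈ C (2 * k)} where
  empty_mem k := by
    obtain ⟨a, ha⟩ := hne
    obtain ⟨y, hy, -⟩ := (hC (2 * k)).cofinal a ha
    refine (hC (2 * k)).isLowerSet (fun i => ?_) hy
    simp [Bool.le_iff_imp, chi_apply_eq_true]
  mem_of_subset k A B h hB := (hC _).isLowerSet (chi_le_chi h) hB
  union_mem k A hA B hB D hD := by
    have hD' : chi D ∈ C (2 * k + 1) := by simpa using hsup _ _ hD _ hD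
    have h := hsup _ _ (hsup _ _ hA _ hB) _ hD'
    simpa only [mem_ofPred_eq, chi_union, mul_add, mul_one, add_assoc, one_add_one_eq_two] using h
  mem_of_forall k A h :=
    (hC _).isClosed.mem_of_tendsto (tendsto_chi_inter_Iio A) (Eventually.of_forall h)

end CharacteristicFunctions

/-- Solecki: every F_σ P-ideal is `Exh(μ) = Fin(μ)` for some
lower semicontinuous submeasure `μ`. -/
theorem stmt1 (I : Set (Set ℕ)) (hI : IsIdeal I) (hP : IsPIdeal I) (hF : FsigmaIdeal I) :
    ∃ μ : Set ℕ → ENNReal, IsLSCSubmeasure μ ∧ I = Exh μ ∧ I = FinSub μ := by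
  have hne : (chi '' I).Nonempty := ⟨_, mem_image_of_mem _ (hI.1 ∅ finite_empty)⟩
  have hunion : ∀ x ∈ chi '' I, ∀ y ∈ chi '' I, x ⊔ y ∈ chi '' I := by
    rintro _ ⟨A, hA, rfl⟩ _ ⟨B, hB, rfl⟩
    exact ⟨A ∪ B, hI.2.2.1 A B hA hB, chi_union A B⟩
  obtain ⟨C, hC, hsup, hcov⟩ := exists_absorbing_scale hP.almostSigmaDirected hne
    (isLowerSet_chi_image hI) hunion hF
  have hmem : ∀ {k A}, chi A ∈ C k → A ∈ I := fun {k A} h =>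
    (chi_injective.mem_set_image).1 ((hC k).subset h)
  have hS := isScale_of_isAbsorbing hne hC hsup
  refine ⟨hS.submeasure, hS.isLSCSubmeasure_submeasure, ?_, ?_⟩
  · rw [hS.exh_submeasure]
    ext A
    refine ⟨fun hA k => ?_, fun h => ?_⟩
    · obtain ⟨y, hy, hle⟩ := (hC (2 * k)).cofinal _ (mem_image_of_mem chi hA)
      obtain ⟨m, hm⟩ := exists_cutBelow_le hle
      exact ⟨m, (hC _).isLowerSet ((chi_sdiff_Iio A m).trans_le hm) hy⟩
    · obtain ⟨m, hm⟩ := h 0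
      refine hI.2.1 A _ ?_ (hI.2.2.1 _ _ (hmem hm) (hI.1 _ (finite_Iio m)))
      rw [sdiff_union_self]
      exact subset_union_left
  · rw [hS.finSub_submeasure]
    ext A
    refine ⟨fun hA => mem_iUnion.2 ?_, fun h => hmem (mem_iUnion.1 h).choose_spec⟩
    obtain ⟨k, hk⟩ := mem_iUnion.1 (hcov (mem_image_of_mem chi hA))
    obtain ⟨j, rfl | rfl⟩ := k.even_or_odd'
    · exact ⟨j, hk⟩
    · refine ⟨j + 1, ?_⟩
      have h := hsup _ _ hk _ hk
      rw [sup_idem, add_assoc, one_add_one_eq_two] at h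
      rwa [mem_ofPred_eq, mul_add, mul_one]
end
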